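/- Let N ≥ 2, 1 < p < N, p < q < ∞, p* := Np/(N−p), r > p* with r ≥ q, and let a : ℤ^N → [0,∞) be either T-periodic for some T ∈ ℕ⁺ (a(x + T e_i) = a(x) for all x ∈ ℤ^N and 1 ≤ i ≤ N, where e_i is the i-th unit vector) or a bounded potential (the limit a_∞ := lim_{|x|→∞} a(x) exists, is finite, and 0 ≤ a(x) ≤ a_∞ for all x). Then for each t > 0 there exist u : ℤ^N → ℝ and λ > 0 such that u(x) > 0 for all x, Σ_{x∈ℤ^N} |u(x)|^r = rt, I(u) = S_t, and L u(x₀) = λ u(x₀)^{r−1} for every x₀ ∈ ℤ^N. -/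

import Mathlib

open Filter Topology
open scoped ENNReal Classical

noncomputable section

abbrev ZN (N : ℕ) := Fin N → ℤ

def adj {N : ℕ} (x y : ZN N) : Prop := (∑ i, (x i - y i).natAbs) = 1

def eInt {N : ℕ} (g : ZN N → ZN N → ℝ) : ℝ≥0∞ :=
  (∑' e : ZN N × ZN N, if adj e.1 e.2 then ENNReal.ofReal (g e.1 e.2) else 0) / 2

def grad {N : ℕ} (u : ZN N → ℝ) (x y : ZN N) : ℝ := u y - u x

def energy {N : ℕ} (p q : ℝ) (a u : ZN N → ℝ) : ℝ≥0∞ :=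
  eInt (fun x y => (1 / p) * |grad u x y| ^ p + (a x / q) * |grad u x y| ^ q)

def gradModular {N : ℕ} (p q : ℝ) (a u : ZN N → ℝ) : ℝ≥0∞ :=
  eInt (fun x y => |grad u x y| ^ p + a x * |grad u x y| ^ q)

def vsum {N : ℕ} (r : ℝ) (u : ZN N → ℝ) : ℝ≥0∞ :=
  ∑' x : ZN N, ENNReal.ofReal (|u x| ^ r)

def Slevel {N : ℕ} (p q : ℝ) (a : ZN N → ℝ) (r t : ℝ) : ℝ≥0∞ :=
  sInf { c : ℝ≥0∞ | ∃ u : ZN N → ℝ, (Function.support u).Finite ∧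
      vsum r u = ENNReal.ofReal (r * t) ∧ energy p q a u = c }

def Lop {N : ℕ} (p q : ℝ) (a u : ZN N → ℝ) (x₀ : ZN N) : ℝ :=
  -(∑' y : ZN N, if adj x₀ y then |u y - u x₀| ^ (p - 2) * (u y - u x₀) else 0)
    - ∑' y : ZN N, if adj x₀ y then
        ((a x₀ + a y) / 2) * (|u y - u x₀| ^ (q - 2) * (u y - u x₀)) else 0

/-! ### The lattice graph -/

lemma adj_symm {N : ℕ} {x y : ZN N} (h : adj x y) : adj y x := by
  unfold adj at *
  rw [← h]
  refine Finset.sum_congr rfl fun i _ => ?_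
  omega

lemma adj_ne {N : ℕ} {x y : ZN N} (h : adj x y) : x ≠ y := by
  rintro rfl
  simp [adj] at h

lemma adj_mem_Icc {N : ℕ} {x y : ZN N} (h : adj x y) :
    y ∈ Finset.Icc (fun i => x i - 1) (fun i => x i + 1) := by
  have key : ∀ i, (x i - y i).natAbs ≤ 1 := fun i => by
    have := Finset.single_le_sum (f := fun i => (x i - y i).natAbs) (fun _ _ => Nat.zero_le _)
      (Finset.mem_univ i)
    unfold adj at h
    omega
  rw [Finset.mem_Icc]
  exact ⟨fun i => by have := key i; show x i - 1 ≤ y i; omega,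
    fun i => by have := key i; show y i ≤ x i + 1; omega⟩

lemma card_Icc_box {N : ℕ} (x : ZN N) :
    (Finset.Icc (fun i => x i - 1) (fun i => x i + 1) : Finset (ZN N)).card = 3 ^ N := by
  rw [Pi.card_Icc]
  simp only [Int.card_Icc]
  have : ∀ i, (x i + 1 + 1 - (x i - 1)).toNat = 3 := fun i => by omega
  simp [this]

lemma adj_add_single {N : ℕ} (x : ZN N) (i : Fin N) : adj x (x + Pi.single i 1) := by
  unfold adj
  rw [Finset.sum_eq_single i]
  · simp
  · intro j _ hj
    simp [hj]
  · simp

lemma adj_translate {N : ℕ} (z x y : ZN N) : adj (x + z) (y + z) ↔ adj x y := by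
  simp [adj]

/-- The lattice is connected: a property that passes to neighbours holds everywhere. -/
lemma adj_induction {N : ℕ} {P : ZN N → Prop} {x : ZN N} (hx : P x)
    (hstep : ∀ x y, adj x y → P x → P y) (y : ZN N) : P y := by
  have line : ∀ (i : Fin N) (k : ℤ) (z : ZN N), P z → P (z + Pi.single i k) := by
    intro i k
    induction k using Int.induction_on with
    | zero => intro z hz; simpa using hz
    | succ k ih =>
      intro z hz
      have := hstep _ _ (adj_add_single _ i) (ih z hz)
      rwa [add_assoc, ← Pi.single_add] at this
    | pred k ih =>
      intro z hz
      refine hstep _ _ (adj_symm (adj_add_single _ i)) ?_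
      have := ih z hz
      rwa [add_assoc, ← Pi.single_add, sub_add_cancel]
  have main : ∀ s : Finset (Fin N), P (x + ∑ i ∈ s, Pi.single i (y i - x i)) := by
    intro s
    induction s using Finset.induction_on with
    | empty => simpa using hx
    | insert i s hi ih =>
      rw [Finset.sum_insert hi, add_comm (Pi.single i _), ← add_assoc]
      exact line _ _ _ ih
  have := main Finset.univ
  rw [Finset.univ_sum_single (fun i => y i - x i)] at this
  convert this using 1
  ext i
  simp

/-- The finitely many ordered edges that meet a finite set of vertices. -/
lemma finite_edges_meeting {N : ℕ} {S : Set (ZN N)} (hS : S.Finite) :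
    {e : ZN N × ZN N | adj e.1 e.2 ∧ (e.1 ∈ S ∨ e.2 ∈ S)}.Finite := by
  let B : ZN N → Finset (ZN N) := fun x => Finset.Icc (fun i => x i - 1) (fun i => x i + 1)
  have h1 : (⋃ x ∈ S, (fun y => (x, y)) '' (B x : Set (ZN N))).Finite :=
    hS.biUnion fun x _ => (B x).finite_toSet.image _
  have h2 : (⋃ x ∈ S, (fun y => (y, x)) '' (B x : Set (ZN N))).Finite :=
    hS.biUnion fun x _ => (B x).finite_toSet.image _
  refine (h1.union h2).subset ?_
  rintro ⟨x, y⟩ ⟨hxy, hx | hy⟩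
  · left
    simp only [Set.mem_iUnion]
    exact ⟨x, hx, y, adj_mem_Icc hxy, rfl⟩
  · right
    simp only [Set.mem_iUnion]
    exact ⟨y, hy, x, adj_mem_Icc (adj_symm hxy), rfl⟩

lemma infinite_lattice {N : ℕ} (hN : 2 ≤ N) : Infinite (ZN N) := by
  have : Nonempty (Fin N) := ⟨⟨0, by omega⟩⟩
  infer_instance

/-! ### Weighted edge densities -/

/-- One power term of the energy density on an ordered pair of vertices. -/
def edgeTerm {N : ℕ} (s : ℝ) (c u : ZN N → ℝ) (e : ZN N × ZN N) : ℝ :=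
  if adj e.1 e.2 then c e.1 * |grad u e.1 e.2| ^ s else 0

/-- The energy density on an ordered pair of vertices. -/
def edgeDensity {N : ℕ} (p q : ℝ) (a u : ZN N → ℝ) (e : ZN N × ZN N) : ℝ :=
  edgeTerm p (fun _ => 1 / p) u e + edgeTerm q (fun x => a x / q) u e

section Density

variable {N : ℕ} {s p q : ℝ} {a b c u v w : ZN N → ℝ}

lemma edgeTerm_nonneg (hc : ∀ x, 0 ≤ c x) (e : ZN N × ZN N) : 0 ≤ edgeTerm s c u e := by
  unfold edgeTerm
  split_ifs
  · exact mul_nonneg (hc _) (Real.rpow_nonneg (abs_nonneg _) _)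
  · exact le_rfl

lemma edgeTerm_mul {k : ℝ} (hk : 0 ≤ k) (e : ZN N × ZN N) :
    edgeTerm s c (fun x => k * u x) e = k ^ s * edgeTerm s c u e := by
  unfold edgeTerm grad
  split_ifs
  · rw [← mul_sub, abs_mul, abs_of_nonneg hk, Real.mul_rpow hk (abs_nonneg _)]
    ring
  · simp

lemma edgeTerm_mono (hs : 0 ≤ s) (hc : ∀ x, 0 ≤ c x) {e : ZN N × ZN N}
    (h : |grad u e.1 e.2| ≤ |grad v e.1 e.2|) : edgeTerm s c u e ≤ edgeTerm s c v e := by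
  unfold edgeTerm
  split_ifs
  · exact mul_le_mul_of_nonneg_left (Real.rpow_le_rpow (abs_nonneg _) h hs) (hc _)
  · exact le_rfl

lemma edgeTerm_congr {e : ZN N × ZN N} (h : grad u e.1 e.2 = grad v e.1 e.2) :
    edgeTerm s c u e = edgeTerm s c v e := by
  simp only [edgeTerm, h]

lemma edgeDensity_nonneg (hp : 0 < p) (hq : 0 < q) (ha : ∀ x, 0 ≤ a x) (e : ZN N × ZN N) :
    0 ≤ edgeDensity p q a u e :=
  add_nonneg (edgeTerm_nonneg (fun _ => by positivity) e)
    (edgeTerm_nonneg (fun x => div_nonneg (ha x) hq.le) e)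

lemma edgeDensity_mono (hp : 0 < p) (hq : 0 < q) (ha : ∀ x, 0 ≤ a x) {e : ZN N × ZN N}
    (h : |grad u e.1 e.2| ≤ |grad v e.1 e.2|) :
    edgeDensity p q a u e ≤ edgeDensity p q a v e :=
  add_le_add (edgeTerm_mono hp.le (fun _ => by positivity) h)
    (edgeTerm_mono hq.le (fun x => div_nonneg (ha x) hq.le) h)

lemma edgeDensity_congr {e : ZN N × ZN N} (h : grad u e.1 e.2 = grad v e.1 e.2) :
    edgeDensity p q a u e = edgeDensity p q a v e := by
  simp only [edgeDensity, edgeTerm, h]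

lemma edgeDensity_mono_coeff (hq : 0 < q) (hab : ∀ x, a x ≤ b x) (e : ZN N × ZN N) :
    edgeDensity p q a u e ≤ edgeDensity p q b u e := by
  unfold edgeDensity edgeTerm
  split_ifs
  · exact add_le_add le_rfl (mul_le_mul_of_nonneg_right
      (div_le_div_of_nonneg_right (hab _) hq.le) (Real.rpow_nonneg (abs_nonneg _) _))
  · simp

lemma edgeDensity_of_not_adj {e : ZN N × ZN N} (h : ¬ adj e.1 e.2) :
    edgeDensity p q a u e = 0 := by
  simp [edgeDensity, edgeTerm, h]

lemma edgeDensity_eq_zero (hp : 0 < p) (hq : 0 < q) {e : ZN N × ZN N}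
    (h : grad u e.1 e.2 = 0) : edgeDensity p q a u e = 0 := by
  simp [edgeDensity, edgeTerm, h, Real.zero_rpow hp.ne', Real.zero_rpow hq.ne']

lemma edgeDensity_mul_le {k r : ℝ} (hk : 1 ≤ k) (hp : 0 < p) (hq : 0 < q) (hpr : p ≤ r)
    (hqr : q ≤ r) (ha : ∀ x, 0 ≤ a x) (e : ZN N × ZN N) :
    edgeDensity p q a (fun x => k * u x) e ≤ k ^ r * edgeDensity p q a u e := by
  unfold edgeDensity
  rw [edgeTerm_mul (by linarith), edgeTerm_mul (by linarith), mul_add]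
  have h1 := Real.rpow_le_rpow_of_exponent_le hk hpr
  have h2 := Real.rpow_le_rpow_of_exponent_le hk hqr
  have e1 : 0 ≤ edgeTerm p (fun _ => 1 / p) u e := edgeTerm_nonneg (fun _ => by positivity) e
  have e2 : 0 ≤ edgeTerm q (fun x => a x / q) u e :=
    edgeTerm_nonneg (fun x => div_nonneg (ha x) hq.le) e
  gcongr

lemma edgeDensity_mul_lt {k r : ℝ} (hk : 1 < k) (hp : 0 < p) (hq : 0 < q) (hpr : p < r)
    (hqr : q ≤ r) (ha : ∀ x, 0 ≤ a x) {e : ZN N × ZN N} (hadj : adj e.1 e.2)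
    (hg : grad u e.1 e.2 ≠ 0) :
    edgeDensity p q a (fun x => k * u x) e < k ^ r * edgeDensity p q a u e := by
  unfold edgeDensity
  rw [edgeTerm_mul (by linarith), edgeTerm_mul (by linarith), mul_add]
  have h1 := Real.rpow_lt_rpow_of_exponent_lt hk hpr
  have h2 := Real.rpow_le_rpow_of_exponent_le hk.le hqr
  have e1 : 0 < edgeTerm p (fun _ => 1 / p) u e := by
    unfold edgeTerm
    rw [if_pos hadj]
    have := Real.rpow_pos_of_pos (abs_pos.2 hg) p
    positivity
  have e2 : 0 ≤ edgeTerm q (fun x => a x / q) u e :=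
    edgeTerm_nonneg (fun x => div_nonneg (ha x) hq.le) e
  exact add_lt_add_of_lt_of_le (mul_lt_mul_of_pos_right h1 e1) (mul_le_mul_of_nonneg_right h2 e2)

lemma edgeDensity_mul_le_of_le_one {k : ℝ} (hk0 : 0 ≤ k) (hk : k ≤ 1) (hp : 0 < p) (hq : 0 < q)
    (ha : ∀ x, 0 ≤ a x) (e : ZN N × ZN N) :
    edgeDensity p q a (fun x => k * u x) e ≤ edgeDensity p q a u e := by
  refine edgeDensity_mono hp hq ha ?_
  unfold grad
  rw [← mul_sub, abs_mul, abs_of_nonneg hk0]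
  exact mul_le_of_le_one_left (abs_nonneg _) hk

lemma grad_eq_zero_of_notMem_support {e : ZN N × ZN N} (h1 : e.1 ∉ Function.support u)
    (h2 : e.2 ∉ Function.support u) : grad u e.1 e.2 = 0 := by
  simp only [Function.mem_support, not_not] at h1 h2
  simp [grad, h1, h2]

lemma summable_edgeDensity_of_finite (hp : 0 < p) (hq : 0 < q) (hu : (Function.support u).Finite) :
    Summable (edgeDensity p q a u) := by
  refine summable_of_hasFiniteSupport ((finite_edges_meeting hu).subset ?_)
  intro e he
  by_contra hcon
  apply he
  by_cases hadj : adj e.1 e.2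
  · have : ¬ (e.1 ∈ Function.support u ∨ e.2 ∈ Function.support u) := fun h => hcon ⟨hadj, h⟩
    push Not at this
    exact edgeDensity_eq_zero hp hq (grad_eq_zero_of_notMem_support this.1 this.2)
  · exact edgeDensity_of_not_adj hadj

lemma tendsto_edgeDensity {ι : Type*} {F : Filter ι} {an un : ι → ZN N → ℝ} (hp : 0 < p)
    (hq : 0 < q) (ha : ∀ x, Tendsto (fun n => an n x) F (𝓝 (a x)))
    (hu : ∀ x, Tendsto (fun n => un n x) F (𝓝 (u x))) (e : ZN N × ZN N) :
    Tendsto (fun n => edgeDensity p q (an n) (un n) e) F (𝓝 (edgeDensity p q a u e)) := by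
  unfold edgeDensity edgeTerm grad
  split_ifs
  · have hg := ((hu e.2).sub (hu e.1)).abs
    exact ((hg.rpow_const (Or.inr hp.le)).const_mul _).add
      (((ha e.1).div_const q).mul (hg.rpow_const (Or.inr hq.le)))
  · exact tendsto_const_nhds

end Density
/-! ### A Sobolev-type lower bound for the maximum -/

lemma ofReal_abs_le_tsum_diff {h : ℤ → ℝ} (hh : (Function.support h).Finite) (j : ℤ) :
    ENNReal.ofReal |h j| ≤ ∑' k : ℤ, ENNReal.ofReal |h (k + 1) - h k| := by
  obtain ⟨n, hn⟩ : ∃ n : ℕ, h (j + n) = 0 := by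
    by_contra hcon
    push Not at hcon
    have hinj : Function.Injective fun n : ℕ => j + (n : ℤ) := fun m n hmn => by
      simpa using hmn
    exact (Set.infinite_of_injective_forall_mem hinj (fun n => hcon n)) hh
  have htel : |h j| ≤ ∑ k ∈ Finset.range n, |h (j + k + 1) - h (j + k)| := by
    have h1 : ∑ k ∈ Finset.range n, (h (j + k + 1) - h (j + k)) = h (j + n) - h j := by
      have := Finset.sum_range_sub (fun k : ℕ => h (j + k)) n
      simp only [Nat.cast_add, Nat.cast_one, Nat.cast_zero, add_zero, ← add_assoc] at this
      exact this
    calc |h j| = |∑ k ∈ Finset.range n, (h (j + k + 1) - h (j + k))| := by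
          rw [h1, hn, zero_sub, abs_neg]
      _ ≤ _ := Finset.abs_sum_le_sum_abs _ _
  have hinj : Function.Injective fun n : ℕ => j + (n : ℤ) := fun m n hmn => by
    simpa using hmn
  calc ENNReal.ofReal |h j|
      ≤ ENNReal.ofReal (∑ k ∈ Finset.range n, |h (j + k + 1) - h (j + k)|) :=
        ENNReal.ofReal_le_ofReal htel
    _ = ∑ k ∈ Finset.range n, ENNReal.ofReal |h (j + k + 1) - h (j + k)| :=
        ENNReal.ofReal_sum_of_nonneg fun _ _ => abs_nonneg _
    _ ≤ ∑' k : ℕ, ENNReal.ofReal |h (j + k + 1) - h (j + k)| := ENNReal.sum_le_tsum _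
    _ ≤ ∑' k : ℤ, ENNReal.ofReal |h (k + 1) - h k| :=
        ENNReal.tsum_comp_le_tsum_of_injective hinj
          (fun k : ℤ => ENNReal.ofReal |h (k + 1) - h k|)

open MeasureTheory in
lemma lintegral_pi_count {N : ℕ} (f : ZN N → ℝ≥0∞) :
    ∫⁻ x, f x ∂(Measure.pi fun _ : Fin N => (Measure.count : Measure ℤ)) = ∑' x, f x := by
  rw [lintegral_countable']
  refine tsum_congr fun x => ?_
  rw [Measure.pi_singleton]
  simp

open MeasureTheory in
/-- The Gagliardo–Nirenberg–Sobolev inequality with exponent one on the lattice. -/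
lemma lattice_sobolev_one {N : ℕ} (hN : 2 ≤ N) {f : ZN N → ℝ}
    (hf : (Function.support f).Finite) :
    ∑' x, ENNReal.ofReal |f x| ^ ((N : ℝ) / (N - 1)) ≤
      (∑' x, ∑' y, if adj x y then ENNReal.ofReal |f y - f x| else 0) ^ ((N : ℝ) / (N - 1)) := by
  have hN1 : (1 : ℝ) < N := by exact_mod_cast hN
  let g : ZN N → ℝ≥0∞ := fun x => ∑' y, if adj x y then ENNReal.ofReal |f y - f x| else 0
  have hline : ∀ x (i : Fin N), ENNReal.ofReal |f x| ≤ ∑' k : ℤ, g (Function.update x i k) := by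
    intro x i
    have hsupp : (Function.support fun k : ℤ => f (Function.update x i k)).Finite := by
      refine Set.Finite.preimage (f := fun k : ℤ => Function.update x i k)
        (Set.injOn_of_injective (Function.update_injective x i)) hf
    have h1 := ofReal_abs_le_tsum_diff hsupp (x i)
    rw [Function.update_eq_self] at h1
    refine h1.trans (ENNReal.tsum_le_tsum fun k => ?_)
    have hadj : adj (Function.update x i k) (Function.update x i (k + 1)) := by
      have := adj_add_single (Function.update x i k) i
      convert this using 1
      ext j
      by_cases hj : j = i
      · subst hj; simp
      · simp [hj]
    refine le_trans ?_ (ENNReal.le_tsum (Function.update x i (k + 1)))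
    rw [if_pos hadj]
  have hcard : (Fintype.card (Fin N) : ℝ) = N := by simp
  have hconj : Real.HolderConjugate (Fintype.card (Fin N)) ((N : ℝ) / (N - 1)) := by
    rw [hcard]
    exact Real.HolderConjugate.conjExponent hN1
  have key := lintegral_prod_lintegral_pow_le (μ := fun _ : Fin N => (Measure.count : Measure ℤ))
    hconj (f := g) (measurable_of_countable g)
  rw [lintegral_pi_count, lintegral_pi_count] at key
  refine le_trans (ENNReal.tsum_le_tsum fun x => ?_) key
  calc ENNReal.ofReal |f x| ^ ((N : ℝ) / (N - 1))
      = ∏ _i : Fin N, ENNReal.ofReal |f x| ^ ((1 : ℝ) / (Fintype.card (Fin N) - 1)) := by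
        rw [Finset.prod_const, ← ENNReal.rpow_natCast, ← ENNReal.rpow_mul]
        congr 1
        simp
        ring
    _ ≤ _ := Finset.prod_le_prod' fun i _ => by
        refine ENNReal.rpow_le_rpow ?_ (by rw [hcard]; exact div_nonneg one_pos.le (by linarith))
        rw [lintegral_count]
        exact hline x i

lemma abs_rpow_sub_rpow_le {γ a b : ℝ} (hγ : 1 ≤ γ) (ha : 0 ≤ a) (hb : 0 ≤ b) :
    |a ^ γ - b ^ γ| ≤ γ * ((a ^ (γ - 1) + b ^ (γ - 1)) * |a - b|) := by
  wlog hab : b ≤ a generalizing a b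
  · rw [abs_sub_comm, abs_sub_comm a b, add_comm (a ^ _)]
    exact this hb ha (le_of_not_ge hab)
  rcases ha.eq_or_lt with rfl | hapos
  · have : b = 0 := le_antisymm hab hb
    subst this
    simp
  have h1 : b ^ γ ≤ a ^ γ := Real.rpow_le_rpow hb hab (by linarith)
  rw [abs_of_nonneg (by linarith), abs_of_nonneg (by linarith)]
  have hber := one_add_mul_self_le_rpow_one_add (s := b / a - 1)
    (by have := div_nonneg hb ha; linarith) hγ
  rw [add_sub_cancel, Real.div_rpow hb ha] at hber
  have hpos : 0 < a ^ γ := Real.rpow_pos_of_pos hapos _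
  rw [le_div_iff₀ hpos] at hber
  have hsplit : a ^ γ = a ^ (γ - 1) * a := by
    rw [Real.rpow_sub_one hapos.ne', div_mul_cancel₀ _ hapos.ne']
  have hexp : (1 + γ * (b / a - 1)) * a ^ γ = a ^ γ - γ * (a ^ (γ - 1) * (a - b)) := by
    rw [hsplit]
    field_simp
    ring
  rw [hexp] at hber
  have h2 : 0 ≤ γ * (b ^ (γ - 1) * (a - b)) := by
    have := Real.rpow_nonneg hb (γ - 1)
    have : 0 ≤ a - b := by linarith
    positivity
  nlinarith

lemma tsum_tsum_adj_comm {N : ℕ} (F : ZN N → ZN N → ℝ≥0∞) :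
    ∑' x, ∑' y, (if adj x y then F x y else 0) = ∑' x, ∑' y, if adj x y then F y x else 0 := by
  rw [ENNReal.tsum_comm]
  refine tsum_congr fun x => tsum_congr fun y => ?_
  simp only [show adj y x ↔ adj x y from ⟨adj_symm, adj_symm⟩]

lemma tsum_adj_const_le {N : ℕ} (x : ZN N) (c : ℝ≥0∞) :
    ∑' y, (if adj x y then c else 0) ≤ 3 ^ N * c := by
  rw [tsum_eq_sum (s := Finset.Icc (fun i => x i - 1) (fun i => x i + 1))
    fun y hy => if_neg fun h => hy (adj_mem_Icc h)]
  refine (Finset.sum_le_card_nsmul _ _ c fun y _ => by split_ifs <;> simp).trans ?_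
  rw [card_Icc_box]
  simp

open MeasureTheory in
lemma tsum_adj_rpow_le {N : ℕ} {p p' γ δ κ r B : ℝ} (hpp : p.HolderConjugate p')
    (hγ : 1 ≤ γ) (hκ : 0 ≤ κ) (hκdef : (γ - 1) * p' = r + κ) (hr : 0 < r) {u : ZN N → ℝ}
    (hδ : 0 ≤ δ) (hu : ∀ x, |u x| ≤ δ)
    (hB : ∑' x, ENNReal.ofReal (|u x| ^ r) = ENNReal.ofReal B) :
    ∑' x, ∑' y, (if adj x y then ENNReal.ofReal |(|u y| ^ γ - |u x| ^ γ)| else 0) ≤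
      2 * ENNReal.ofReal γ * ((3 ^ N * ENNReal.ofReal (δ ^ κ * B)) ^ (1 / p') *
        (∑' e, ENNReal.ofReal (edgeTerm p (fun _ => 1) u e)) ^ (1 / p)) := by
  let G : ZN N → ZN N → ℝ≥0∞ := fun x y => ENNReal.ofReal (|u x| ^ (γ - 1) * |u y - u x|)
  have hpt : ∀ x y, (if adj x y then ENNReal.ofReal |(|u y| ^ γ - |u x| ^ γ)| else 0) ≤
      ENNReal.ofReal γ * ((if adj x y then G x y else 0) + (if adj x y then G y x else 0)) := by
    intro x y
    split_ifs
    · have hn1 := Real.rpow_nonneg (abs_nonneg (u x)) (γ - 1)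
      have hn2 := Real.rpow_nonneg (abs_nonneg (u y)) (γ - 1)
      simp only [G]
      rw [← ENNReal.ofReal_add (by positivity) (by positivity),
        ← ENNReal.ofReal_mul (by linarith)]
      refine ENNReal.ofReal_le_ofReal ?_
      refine (abs_rpow_sub_rpow_le hγ (abs_nonneg _) (abs_nonneg _)).trans ?_
      rw [abs_sub_comm (u x) (u y)]
      have := abs_abs_sub_abs_le_abs_sub (u y) (u x)
      calc _ ≤ γ * ((|u y| ^ (γ - 1) + |u x| ^ (γ - 1)) * |u y - u x|) := by gcongr
        _ = _ := by ring
    · simp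
  have hsum : ∑' x, ∑' y, (if adj x y then ENNReal.ofReal |(|u y| ^ γ - |u x| ^ γ)| else 0) ≤
      2 * ENNReal.ofReal γ * ∑' x, ∑' y, (if adj x y then G x y else 0) := by
    refine (ENNReal.tsum_le_tsum fun x => ENNReal.tsum_le_tsum fun y => hpt x y).trans ?_
    simp only [ENNReal.tsum_mul_left, ENNReal.tsum_add]
    rw [tsum_tsum_adj_comm (fun x y => G y x)]
    exact le_of_eq (by ring)
  refine hsum.trans ?_
  gcongr
  let X : ZN N × ZN N → ℝ≥0∞ := fun e =>
    if adj e.1 e.2 then ENNReal.ofReal (|u e.1| ^ (γ - 1)) else 0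
  let Y : ZN N × ZN N → ℝ≥0∞ := fun e => if adj e.1 e.2 then ENNReal.ofReal |u e.2 - u e.1| else 0
  have hol := ENNReal.lintegral_mul_le_Lp_mul_Lq (Measure.count : Measure (ZN N × ZN N)) hpp.symm
    (measurable_of_countable X).aemeasurable (measurable_of_countable Y).aemeasurable
  simp only [lintegral_count] at hol
  have hXY : ∑' e, (X * Y) e = ∑' x, ∑' y, (if adj x y then G x y else 0) := by
    rw [← ENNReal.tsum_prod]
    refine tsum_congr fun e => ?_
    simp only [X, Y, G, Pi.mul_apply]
    split_ifs
    · rw [ENNReal.ofReal_mul (Real.rpow_nonneg (abs_nonneg _) _)]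
    · simp
  rw [hXY] at hol
  refine hol.trans ?_
  have hp0 : 0 < p := hpp.pos
  have hp0' : 0 < p' := hpp.symm.pos
  gcongr ?_ * ?_
  · refine ENNReal.rpow_le_rpow ?_ (by positivity)
    rw [ENNReal.tsum_prod' (f := fun e => X e ^ p')]
    have hx : ∀ x, ∑' y, X (x, y) ^ p' ≤
        3 ^ N * (ENNReal.ofReal (δ ^ κ) * ENNReal.ofReal (|u x| ^ r)) := by
      intro x
      have : ∀ y, X (x, y) ^ p' =
          if adj x y then ENNReal.ofReal (|u x| ^ (r + κ)) else 0 := by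
        intro y
        simp only [X]
        split_ifs
        · rw [ENNReal.ofReal_rpow_of_nonneg (Real.rpow_nonneg (abs_nonneg _) _) hp0'.le,
            ← Real.rpow_mul (abs_nonneg _), hκdef]
        · exact ENNReal.zero_rpow_of_pos hp0'
      simp only [this]
      refine (tsum_adj_const_le x _).trans ?_
      gcongr
      rw [← ENNReal.ofReal_mul (Real.rpow_nonneg hδ _)]
      refine ENNReal.ofReal_le_ofReal ?_
      rw [add_comm r, Real.rpow_add_of_nonneg (abs_nonneg _) hκ hr.le]
      exact mul_le_mul_of_nonneg_right (Real.rpow_le_rpow (abs_nonneg _) (hu x) hκ)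
        (Real.rpow_nonneg (abs_nonneg _) _)
    refine (ENNReal.tsum_le_tsum hx).trans (le_of_eq ?_)
    rw [ENNReal.tsum_mul_left, ENNReal.tsum_mul_left, hB,
      ENNReal.ofReal_mul (Real.rpow_nonneg hδ _)]
  · refine ENNReal.rpow_le_rpow ?_ (by positivity)
    refine ENNReal.tsum_le_tsum fun e => ?_
    simp only [Y, edgeTerm, grad]
    split_ifs
    · rw [ENNReal.ofReal_rpow_of_nonneg (abs_nonneg _) hp0.le, one_mul]
    · simp [hp0]

/-- Above the critical Sobolev exponent, functions of fixed `ℓ^r` mass and bounded `p`-energy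
cannot be uniformly small. -/
lemma exists_le_abs_of_bounded_energy {N : ℕ} (hN : 2 ≤ N) {p r B E : ℝ} (hp : 1 < p)
    (hpN : p < N) (hr : (N : ℝ) * p / (N - p) < r) (hB : 0 < B) :
    ∃ δ : ℝ, 0 < δ ∧ ∀ u : ZN N → ℝ, (Function.support u).Finite →
      ∑' x, ENNReal.ofReal (|u x| ^ r) = ENNReal.ofReal B →
      ∑' e, ENNReal.ofReal (edgeTerm p (fun _ => 1) u e) ≤ ENNReal.ofReal E →
      ∃ x, δ ≤ |u x| := by
  have hN1 : (1 : ℝ) < N := by exact_mod_cast hN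
  have hrN : (N : ℝ) * p < r * (N - p) := by rwa [div_lt_iff₀ (by linarith)] at hr
  have hr0 : 0 < r := lt_of_le_of_lt (div_nonneg (by positivity) (by linarith)) hr
  set p' := p / (p - 1) with hp'
  have hpp : p.HolderConjugate p' := Real.HolderConjugate.conjExponent hp
  set γ := r * (N - 1) / N with hγdef
  set κ := (γ - 1) * p' - r with hκdef
  have hκ : 0 < κ := by
    have : κ = (r * (N - p) - N * p) / (N * (p - 1)) := by
      rw [hκdef, hγdef, hp']
      have : p - 1 ≠ 0 := by linarith
      field_simp
      ring
    rw [this]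
    exact div_pos (by linarith) (mul_pos (by linarith) (by linarith))
  have hγ : 1 ≤ γ := by
    by_contra hcon
    have : (γ - 1) * p' ≤ 0 := mul_nonpos_of_nonpos_of_nonneg (by linarith) hpp.symm.pos.le
    linarith
  set R : ℝ → ℝ≥0∞ := fun δ => 2 * ENNReal.ofReal γ *
    ((3 ^ N * ENNReal.ofReal (δ ^ κ * B)) ^ (1 / p') * (ENNReal.ofReal E) ^ (1 / p)) with hR
  have hlim : Tendsto (fun δ => R δ ^ ((N : ℝ) / (N - 1))) (𝓝 0) (𝓝 0) := by
    have h1 : Tendsto (fun δ : ℝ => δ ^ κ * B) (𝓝 0) (𝓝 0) := by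
      have := ((Real.continuousAt_rpow_const 0 κ (Or.inr hκ.le)).tendsto).mul_const B
      simpa [Real.zero_rpow hκ.ne'] using this
    have h2 : Tendsto (fun δ : ℝ => 3 ^ N * ENNReal.ofReal (δ ^ κ * B)) (𝓝 0) (𝓝 0) := by
      have := ENNReal.Tendsto.const_mul (a := 3 ^ N) (ENNReal.tendsto_ofReal h1)
        (Or.inr (by finiteness))
      simpa using this
    have h3 := (ENNReal.continuous_rpow_const (y := 1 / p')).tendsto 0 |>.comp h2
    have h4 := ENNReal.Tendsto.mul_const (b := (ENNReal.ofReal E) ^ (1 / p)) h3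
      (Or.inr (ENNReal.rpow_ne_top_of_nonneg (by positivity) ENNReal.ofReal_ne_top))
    have h5 := ENNReal.Tendsto.const_mul (a := 2 * ENNReal.ofReal γ) h4 (Or.inr (by finiteness))
    have hpos : 0 < 1 / p' := by have := hpp.symm.pos; positivity
    have hpos2 : 0 < (N : ℝ) / (N - 1) := div_pos (by linarith) (by linarith)
    have h6 := (ENNReal.continuous_rpow_const (y := (N : ℝ) / (N - 1))).tendsto _ |>.comp h5
    rw [ENNReal.zero_rpow_of_pos hpos, zero_mul, mul_zero, ENNReal.zero_rpow_of_pos hpos2] at h6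
    exact h6
  have hev : ∀ᶠ δ in 𝓝[>] (0 : ℝ), R δ ^ ((N : ℝ) / (N - 1)) < ENNReal.ofReal B :=
    (hlim.mono_left nhdsWithin_le_nhds).eventually_lt_const (by simpa using hB)
  obtain ⟨δ, hδ, hδ0⟩ := (hev.and self_mem_nhdsWithin).exists
  refine ⟨δ, hδ0, fun u hu hm hE => ?_⟩
  by_contra hcon
  push Not at hcon
  have hδ0' : (0 : ℝ) < δ := hδ0
  have hsupp : (Function.support fun x => |u x| ^ γ).Finite := by
    refine hu.subset fun x hx => ?_
    simp only [Function.mem_support] at hx ⊢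
    rintro h0
    exact hx (by rw [h0, abs_zero, Real.zero_rpow (by linarith)])
  have h1 := lattice_sobolev_one hN hsupp
  have h2 : ∑' x, ENNReal.ofReal |(|u x| ^ γ)| ^ ((N : ℝ) / (N - 1)) = ENNReal.ofReal B := by
    rw [← hm]
    refine tsum_congr fun x => ?_
    rw [abs_of_nonneg (Real.rpow_nonneg (abs_nonneg _) _),
      ENNReal.ofReal_rpow_of_nonneg (Real.rpow_nonneg (abs_nonneg _) _)
        (div_nonneg (by linarith) (by linarith)), ← Real.rpow_mul (abs_nonneg _)]
    congr 2
    have : (N : ℝ) - 1 ≠ 0 := by linarith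
    rw [hγdef]
    field_simp
  rw [h2] at h1
  refine absurd (h1.trans (ENNReal.rpow_le_rpow ?_ (div_nonneg (by linarith) (by linarith))))
    (not_le.2 hδ)
  refine (tsum_adj_rpow_le hpp hγ hκ.le (by rw [hκdef]; ring) hr0 hδ0'.le
    (fun x => (hcon x).le) hm).trans ?_
  simp only [hR]
  have hp0 : 0 < p := by linarith
  gcongr
/-! ### Truncation and scaling -/

/-- Truncation of the absolute value from below at level `ε`. -/
def lowerTrunc {N : ℕ} (ε : ℝ) (v : ZN N → ℝ) (x : ZN N) : ℝ := max (|v x| - ε) 0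

section Minimization

variable {N : ℕ} {p q r B σ : ℝ} {a b v w : ZN N → ℝ}

lemma lowerTrunc_nonneg (ε : ℝ) (x : ZN N) : 0 ≤ lowerTrunc ε v x := le_max_right _ _

lemma lowerTrunc_le {ε : ℝ} (hε : 0 ≤ ε) (x : ZN N) : lowerTrunc ε v x ≤ |v x| :=
  max_le (by linarith) (abs_nonneg _)

lemma tendsto_lowerTrunc (x : ZN N) :
    Tendsto (fun ε => lowerTrunc ε v x) (𝓝[>] 0) (𝓝 |v x|) := by
  have : Continuous fun ε : ℝ => max (|v x| - ε) 0 := by fun_prop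
  have h := this.tendsto 0
  simp only [sub_zero, max_eq_left (abs_nonneg (v x))] at h
  exact h.mono_left nhdsWithin_le_nhds

lemma finite_support_lowerTrunc (hr : 0 < r) (hv : Summable fun x => |v x| ^ r) {ε : ℝ}
    (hε : 0 < ε) : (Function.support (lowerTrunc ε v)).Finite := by
  have h := hv.tendsto_cofinite_zero.eventually_lt_const (Real.rpow_pos_of_pos hε r)
  rw [Filter.eventually_cofinite] at h
  refine h.subset fun x hx => ?_
  simp only [Set.mem_ofPred_eq, not_lt]
  refine Real.rpow_le_rpow hε.le ?_ hr.le
  by_contra hcon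
  push Not at hcon
  exact hx (max_eq_right (by linarith))

lemma abs_grad_lowerTrunc_le (ε : ℝ) (x y : ZN N) :
    |grad (lowerTrunc ε v) x y| ≤ |grad v x y| := by
  unfold grad lowerTrunc
  refine (abs_max_sub_max_le_abs _ _ _).trans ?_
  rw [sub_sub_sub_cancel_right]
  exact abs_abs_sub_abs_le_abs_sub _ _

lemma tendsto_mass_lowerTrunc (hr : 0 < r) (hv : Summable fun x => |v x| ^ r) :
    Tendsto (fun ε => ∑' x, |lowerTrunc ε v x| ^ r) (𝓝[>] 0) (𝓝 (∑' x, |v x| ^ r)) := by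
  refine tendsto_tsum_of_dominated_convergence hv (fun x => ?_) ?_
  · have := ((tendsto_lowerTrunc (v := v) x).abs).rpow_const (p := r) (Or.inr hr.le)
    rwa [abs_abs] at this
  · filter_upwards [self_mem_nhdsWithin] with ε hε x
    rw [Real.norm_of_nonneg (Real.rpow_nonneg (abs_nonneg _) _),
      abs_of_nonneg (lowerTrunc_nonneg _ _)]
    exact Real.rpow_le_rpow (lowerTrunc_nonneg _ _) (lowerTrunc_le (le_of_lt hε) x) hr.le

lemma tsum_abs_mul_rpow {k : ℝ} (hk : 0 ≤ k) (u : ZN N → ℝ) :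
    ∑' x, |k * u x| ^ r = k ^ r * ∑' x, |u x| ^ r := by
  rw [← tsum_mul_left]
  refine tsum_congr fun x => ?_
  rw [abs_mul, abs_of_nonneg hk, Real.mul_rpow hk (abs_nonneg _)]

lemma finite_support_const_mul (k : ℝ) {u : ZN N → ℝ} (hu : (Function.support u).Finite) :
    (Function.support fun x => k * u x).Finite := by
  refine hu.subset fun x hx => ?_
  simp only [Function.mem_support] at hx ⊢
  exact right_ne_zero_of_mul hx

lemma rpow_inv_rpow_cancel {c : ℝ} (hc : 0 ≤ c) (hr : 0 < r) : (c ^ (1 / r)) ^ r = c := by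
  rw [← Real.rpow_mul hc, one_div, inv_mul_cancel₀ hr.ne', Real.rpow_one]

/-- The infimum at mass `B` controls the energy at every mass, since the energy grows at most
like the mass under scaling. -/
lemma min_mass_mul_le_energy (hp : 0 < p) (hpq : p < q) (hqr : q ≤ r) (ha : ∀ x, 0 ≤ a x)
    (hB : 0 < B)
    (H : ∀ w : ZN N → ℝ, (Function.support w).Finite → ∑' x, |w x| ^ r = B →
      σ ≤ ∑' e, edgeDensity p q a w e)
    (hw : (Function.support w).Finite) :
    min (∑' x, |w x| ^ r) B / B * σ ≤ ∑' e, edgeDensity p q a w e := by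
  have hq : 0 < q := hp.trans hpq
  have hr : 0 < r := hq.trans_le hqr
  set m := ∑' x, |w x| ^ r with hm
  have hm0 : 0 ≤ m := tsum_nonneg fun x => Real.rpow_nonneg (abs_nonneg _) _
  have hJ : 0 ≤ ∑' e, edgeDensity p q a w e := tsum_nonneg fun e => edgeDensity_nonneg hp hq ha e
  rcases hm0.eq_or_lt with h0 | hmpos
  · rw [← h0, min_eq_left hB.le]
    simpa using hJ
  set k := (B / m) ^ (1 / r) with hk
  have hBm : 0 < B / m := div_pos hB hmpos
  have hk0 : 0 ≤ k := Real.rpow_nonneg hBm.le _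
  have hkr : k ^ r = B / m := rpow_inv_rpow_cancel hBm.le hr
  have hfin := finite_support_const_mul k hw
  have hmass : ∑' x, |k * w x| ^ r = B := by
    rw [tsum_abs_mul_rpow hk0, hkr, ← hm, div_mul_cancel₀ _ hmpos.ne']
  have h1 := H _ hfin hmass
  have hsw := summable_edgeDensity_of_finite (a := a) hp hq hw
  have hskw := summable_edgeDensity_of_finite (a := a) hp hq hfin
  rcases le_total m B with hmB | hmB
  · have hk1 : 1 ≤ k := Real.one_le_rpow ((one_le_div hmpos).2 hmB) (by positivity)
    have h2 : σ ≤ B / m * ∑' e, edgeDensity p q a w e := by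
      rw [← hkr, ← tsum_mul_left]
      exact h1.trans (hskw.tsum_le_tsum
        (fun e => edgeDensity_mul_le hk1 hp hq (by linarith) hqr ha e) (hsw.mul_left _))
    rw [min_eq_left hmB]
    calc m / B * σ ≤ m / B * (B / m * ∑' e, edgeDensity p q a w e) := by gcongr
      _ = _ := by field_simp
  · have hk1 : k ≤ 1 := Real.rpow_le_one hBm.le ((div_le_one hmpos).2 hmB) (by positivity)
    rw [min_eq_right hmB, div_self hB.ne', one_mul]
    exact h1.trans (hskw.tsum_le_tsum
      (fun e => edgeDensity_mul_le_of_le_one hk0 hk1 hp hq ha e) hsw)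

/-- A lower bound on finitely supported functions extends to all functions of finite energy. -/
lemma le_energy_of_finite_energy (hp : 0 < p) (hpq : p < q) (hqr : q ≤ r) (ha : ∀ x, 0 ≤ a x)
    (hB : 0 < B)
    (H : ∀ w : ZN N → ℝ, (Function.support w).Finite → ∑' x, |w x| ^ r = B →
      σ ≤ ∑' e, edgeDensity p q a w e)
    (hv : Summable fun x => |v x| ^ r) (hvB : ∑' x, |v x| ^ r = B)
    (hJ : Summable (edgeDensity p q a v)) : σ ≤ ∑' e, edgeDensity p q a v e := by
  have hq : 0 < q := hp.trans hpq
  have hr : 0 < r := hq.trans_le hqr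
  have hlim := (((tendsto_mass_lowerTrunc hr hv).min (tendsto_const_nhds (x := B))).div_const
    B).mul_const σ
  rw [hvB, min_self, div_self hB.ne', one_mul] at hlim
  refine le_of_tendsto hlim ?_
  filter_upwards [self_mem_nhdsWithin] with ε hε
  have hfin := finite_support_lowerTrunc hr hv hε
  refine (min_mass_mul_le_energy hp hpq hqr ha hB H hfin).trans ?_
  exact (summable_edgeDensity_of_finite hp hq hfin).tsum_le_tsum
    (fun e => edgeDensity_mono hp hq ha (abs_grad_lowerTrunc_le ε _ _)) hJ

/-! ### Compactness of minimizing sequences -/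

/-- Modifying the terms of a convergent family of series on a finite set. -/
lemma tendsto_tsum_of_eq_off_finite {α ι : Type*} {F : Filter ι} {fn gn : ι → α → ℝ}
    {f g : α → ℝ} {M : ℝ} {K : Set α} (hK : K.Finite)
    (hfn : ∀ n, Summable (fn n)) (hgn : ∀ n, Summable (gn n)) (hf : Summable f) (hg : Summable g)
    (hoff : ∀ n, ∀ e ∉ K, fn n e = gn n e) (hoff' : ∀ e ∉ K, f e = g e)
    (hflim : ∀ e, Tendsto (fun n => fn n e) F (𝓝 (f e)))
    (hglim : ∀ e, Tendsto (fun n => gn n e) F (𝓝 (g e)))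
    (hM : Tendsto (fun n => ∑' e, fn n e) F (𝓝 M)) :
    Tendsto (fun n => ∑' e, gn n e) F (𝓝 (M - ∑' e, f e + ∑' e, g e)) := by
  have key : ∀ {φ ψ : α → ℝ}, Summable φ → Summable ψ → (∀ e ∉ K, φ e = ψ e) →
      ∑' e, φ e - ∑' e, ψ e = ∑ e ∈ hK.toFinset, (φ e - ψ e) := by
    intro φ ψ hφ hψ h
    rw [← hφ.tsum_sub hψ]
    exact tsum_eq_sum fun e he => by
      rw [h e (by simpa using he), sub_self]
  have h1 : Tendsto (fun n => ∑ e ∈ hK.toFinset, (fn n e - gn n e)) F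
      (𝓝 (∑ e ∈ hK.toFinset, (f e - g e))) :=
    tendsto_finsetSum _ fun e _ => (hflim e).sub (hglim e)
  rw [← key hf hg hoff'] at h1
  have h2 := hM.sub h1
  rw [← sub_add] at h2
  refine h2.congr fun n => ?_
  rw [← key (hfn n) (hgn n) (hoff n)]
  ring

lemma summable_and_tsum_le_of_tendsto {α ι : Type*} {F : Filter ι} [F.NeBot]
    {fn : ι → α → ℝ} {f : α → ℝ} {M : ℝ} {Mn : ι → ℝ} (hfn0 : ∀ n e, 0 ≤ fn n e)
    (hfn : ∀ n, Summable (fn n))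
    (hle : ∀ n, ∑' e, fn n e ≤ Mn n) (hM : Tendsto Mn F (𝓝 M))
    (hf : ∀ e, Tendsto (fun n => fn n e) F (𝓝 (f e))) :
    Summable f ∧ ∑' e, f e ≤ M := by
  have hf0 : 0 ≤ f := fun e => ge_of_tendsto' (hf e) fun n => hfn0 n e
  have hs : ∀ s : Finset α, ∑ e ∈ s, f e ≤ M := fun s =>
    le_of_tendsto_of_tendsto' (tendsto_finsetSum s fun e _ => hf e) hM fun n =>
      ((hfn n).sum_le_tsum s fun e _ => hfn0 n e).trans (hle n)
  exact ⟨summable_of_sum_le hf0 hs, Real.tsum_le_of_sum_le hf0 hs⟩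

lemma summable_abs_rpow_of_finite (hr : 0 < r) (hw : (Function.support w).Finite) :
    Summable fun x => |w x| ^ r := by
  refine summable_of_hasFiniteSupport (hw.subset fun x hx => ?_)
  simp only [Function.mem_support] at hx ⊢
  rintro h0
  exact hx (by rw [h0, abs_zero, Real.zero_rpow hr.ne'])

lemma tendsto_energy_min (hp : 0 < p) (hq : 0 < q) (ha : ∀ x, 0 ≤ a x) (hv0 : ∀ x, 0 ≤ v x)
    (hJ : Summable (edgeDensity p q a v)) :
    Tendsto (fun ε => ∑' e, edgeDensity p q a (fun x => min (v x) ε) e) (𝓝[>] 0) (𝓝 0) := by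
  have h0 : ∑' e, edgeDensity p q a (fun _ : ZN N => (0 : ℝ)) e = 0 := by
    rw [← tsum_zero]
    exact tsum_congr fun e => edgeDensity_eq_zero hp hq (by simp [grad])
  suffices h : Tendsto (fun ε => ∑' e, edgeDensity p q a (fun x => min (v x) ε) e) (𝓝[>] 0)
      (𝓝 (∑' e, edgeDensity p q a (fun _ : ZN N => (0 : ℝ)) e)) by rwa [h0] at h
  refine tendsto_tsum_of_dominated_convergence hJ (fun e => ?_) (Eventually.of_forall fun ε e => ?_)
  · refine tendsto_edgeDensity hp hq (fun x => tendsto_const_nhds) (fun x => ?_) e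
    have : Continuous fun ε : ℝ => min (v x) ε := by fun_prop
    have h := this.tendsto 0
    rw [min_eq_right (hv0 x)] at h
    exact h.mono_left nhdsWithin_le_nhds
  · rw [Real.norm_of_nonneg (edgeDensity_nonneg hp hq ha e)]
    refine edgeDensity_mono hp hq ha ?_
    unfold grad
    exact abs_min_sub_min_le_max _ _ _ _ |>.trans (by simp)

lemma exists_grad_ne_zero (hN : 2 ≤ N) (hr : 0 < r) (hv : Summable fun x => |v x| ^ r)
    (hne : ∃ x, v x ≠ 0) : ∃ e : ZN N × ZN N, adj e.1 e.2 ∧ grad v e.1 e.2 ≠ 0 := by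
  by_contra hcon
  push Not at hcon
  obtain ⟨x, hx⟩ := hne
  have hconst : ∀ y, v y = v x := adj_induction (P := fun y => v y = v x) rfl
    fun y z hyz hy => by
      have := hcon (y, z) hyz
      simp only [grad, sub_eq_zero] at this
      rw [this, hy]
  have := infinite_lattice hN
  simp only [hconst] at hv
  rw [summable_const_iff] at hv
  exact hx (by simpa using (Real.rpow_eq_zero (abs_nonneg _) hr.ne').1 hv)

/-- The energy splitting along a sequence of finitely supported functions of mass `B` whose
energies converge to the infimum `σ`. -/
lemma energy_le_add_energy_min (hp : 0 < p) (hpq : p < q) (hqr : q ≤ r)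
    (hb : ∀ x, 0 ≤ b x) (hB : 0 < B) (hσ : 0 ≤ σ)
    {F : Filter ℕ} [F.NeBot] {an un : ℕ → ZN N → ℝ} (han : ∀ n x, 0 ≤ an n x)
    (hanlim : ∀ x, Tendsto (fun n => an n x) F (𝓝 (b x)))
    (hfin : ∀ n, (Function.support (un n)).Finite)
    (hmass : ∀ n, ∑' x, |un n x| ^ r = B)
    (henergy : Tendsto (fun n => ∑' e, edgeDensity p q (an n) (un n) e) F (𝓝 σ))
    (hunlim : ∀ x, Tendsto (fun n => un n x) F (𝓝 (v x))) (hv0 : ∀ x, 0 ≤ v x)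
    (hvs : Summable fun x => |v x| ^ r)
    (hvJ : Summable (edgeDensity p q b v))
    (Hn : ∀ n, ∀ w : ZN N → ℝ, (Function.support w).Finite → ∑' x, |w x| ^ r = B →
      σ ≤ ∑' e, edgeDensity p q (an n) w e) {ε : ℝ} (hε : 0 < ε) :
    ∑' e, edgeDensity p q b v e ≤ (∑' x, |v x| ^ r) / B * σ +
      ∑' e, edgeDensity p q b (fun x => min (v x) ε) e := by
  have hq : 0 < q := hp.trans hpq
  have hr : 0 < r := hq.trans_le hqr
  have hunr : ∀ x, Tendsto (fun n => |un n x| ^ r) F (𝓝 (|v x| ^ r)) := fun x =>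
    ((hunlim x).abs).rpow_const (Or.inr hr.le)
  have hunJ : ∀ e, Tendsto (fun n => edgeDensity p q (an n) (un n) e) F
      (𝓝 (edgeDensity p q b v e)) := tendsto_edgeDensity hp hq hanlim hunlim
  set s := ∑' x, |v x| ^ r with hs
  have hs0 : 0 ≤ s := tsum_nonneg fun x => Real.rpow_nonneg (abs_nonneg _) _
  set w := lowerTrunc ε v with hw
  have hwfin : (Function.support w).Finite := finite_support_lowerTrunc hr hvs hε
  have hvw : ∀ x, v x - w x = min (v x) ε := by
    intro x
    rw [hw, lowerTrunc, abs_of_nonneg (hv0 x)]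
    rcases le_total (v x) ε with h | h
    · rw [max_eq_right (by linarith), min_eq_left h, sub_zero]
    · rw [max_eq_left (by linarith), min_eq_right h, sub_sub_cancel]
  have hdfin : ∀ n, (Function.support fun x => un n x - w x).Finite := fun n =>
    ((hfin n).union hwfin).subset (Function.support_sub _ _)
  have hdlim : ∀ x, Tendsto (fun n => un n x - w x) F (𝓝 (min (v x) ε)) := fun x => by
    rw [← hvw]
    exact (hunlim x).sub_const _
  have hmins : Summable fun x => |min (v x) ε| ^ r := by
    refine hvs.of_nonneg_of_le (fun x => Real.rpow_nonneg (abs_nonneg _) _) fun x => ?_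
    refine Real.rpow_le_rpow (abs_nonneg _) ?_ hr.le
    rw [abs_of_nonneg (le_min (hv0 x) hε.le), abs_of_nonneg (hv0 x)]
    exact min_le_left _ _
  have hminJ : Summable (edgeDensity p q b fun x => min (v x) ε) := by
    refine hvJ.of_nonneg_of_le (fun e => edgeDensity_nonneg hp hq hb e) fun e => ?_
    refine edgeDensity_mono hp hq hb ?_
    unfold grad
    exact abs_min_sub_min_le_max _ _ _ _ |>.trans (by simp)
  have hmasslim := tendsto_tsum_of_eq_off_finite (F := F) (M := B) hwfin
    (fun n => summable_abs_rpow_of_finite hr (hfin n))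
    (fun n => summable_abs_rpow_of_finite hr (hdfin n)) hvs hmins
    (fun n x hx => by rw [Function.notMem_support.1 hx, sub_zero])
    (fun x hx => by rw [← hvw, Function.notMem_support.1 hx, sub_zero]) hunr
    (fun x => ((hdlim x).abs).rpow_const (Or.inr hr.le))
    (by simp only [hmass]; exact tendsto_const_nhds)
  have hoff : ∀ (c f : ZN N → ℝ) (e : ZN N × ZN N),
      e ∉ {e : ZN N × ZN N | adj e.1 e.2 ∧
        (e.1 ∈ Function.support w ∨ e.2 ∈ Function.support w)} →
      edgeDensity p q c f e = edgeDensity p q c (fun x => f x - w x) e := by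
    intro c f e he
    by_cases hadj : adj e.1 e.2
    · have : ¬ (e.1 ∈ Function.support w ∨ e.2 ∈ Function.support w) := fun h => he ⟨hadj, h⟩
      push Not at this
      refine edgeDensity_congr ?_
      simp only [grad, Function.notMem_support.1 this.1, Function.notMem_support.1 this.2,
        sub_zero]
    · rw [edgeDensity_of_not_adj hadj, edgeDensity_of_not_adj hadj]
  have hJlim := tendsto_tsum_of_eq_off_finite (F := F) (finite_edges_meeting hwfin)
    (fun n => summable_edgeDensity_of_finite hp hq (hfin n))
    (fun n => summable_edgeDensity_of_finite (a := an n) hp hq (hdfin n)) hvJ hminJ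
    (fun n e he => hoff _ _ e he)
    (fun e he => by simp only [← hvw]; exact hoff _ _ e he) hunJ
    (tendsto_edgeDensity hp hq hanlim hdlim) henergy
  have hle := le_of_tendsto_of_tendsto'
    (((hmasslim.min (tendsto_const_nhds (x := B))).div_const B).mul_const σ) hJlim
    fun n => min_mass_mul_le_energy hp hpq hqr (han n) hB (Hn n) (hdfin n)
  have hm0 : 0 ≤ ∑' x, |min (v x) ε| ^ r :=
    tsum_nonneg fun x => Real.rpow_nonneg (abs_nonneg _) _
  have h3 : B - s ≤ min (B - s + ∑' x, |min (v x) ε| ^ r) B := le_min (by linarith) (by linarith)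
  have h4 : (B - s) / B * σ ≤ min (B - s + ∑' x, |min (v x) ε| ^ r) B / B * σ := by gcongr
  have h5 : (B - s) / B * σ = σ - s / B * σ := by field_simp
  linarith

/-- Strict subadditivity: below mass `B` the energy per mass is strictly larger than at `B`. -/
lemma lt_energy_of_mass_lt (hN : 2 ≤ N) (hp : 0 < p) (hpq : p < q) (hqr : q ≤ r)
    (ha : ∀ x, 0 ≤ a x) (hv : ∃ x, v x ≠ 0)
    (H : ∀ w : ZN N → ℝ, (Function.support w).Finite → ∑' x, |w x| ^ r = B →
      σ ≤ ∑' e, edgeDensity p q a w e)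
    (hvs : Summable fun x => |v x| ^ r) (hvJa : Summable (edgeDensity p q a v))
    (hspos : 0 < ∑' x, |v x| ^ r) (hlt : ∑' x, |v x| ^ r < B) :
    σ < B / (∑' x, |v x| ^ r) * ∑' e, edgeDensity p q a v e := by
  have hq : 0 < q := hp.trans hpq
  have hr : 0 < r := hq.trans_le hqr
  have hB : 0 < B := hspos.trans hlt
  set s := ∑' x, |v x| ^ r with hs
  set k := (B / s) ^ (1 / r) with hk
  have hBs : 0 < B / s := div_pos hB hspos
  have hk1 : 1 < k := Real.one_lt_rpow ((one_lt_div hspos).2 hlt) (by positivity)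
  have hk0 : 0 ≤ k := by linarith
  have hkr : k ^ r = B / s := rpow_inv_rpow_cancel hBs.le hr
  have hks : Summable fun x => |k * v x| ^ r := by
    refine (hvs.mul_left (k ^ r)).congr fun x => ?_
    rw [abs_mul, abs_of_nonneg hk0, Real.mul_rpow hk0 (abs_nonneg _)]
  have hkmass : ∑' x, |k * v x| ^ r = B := by
    rw [tsum_abs_mul_rpow hk0, hkr, ← hs, div_mul_cancel₀ _ hspos.ne']
  have hkle := fun e => edgeDensity_mul_le (u := v) hk1.le hp hq (by linarith) hqr ha e
  have hkJ : Summable (edgeDensity p q a fun x => k * v x) :=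
    (hvJa.mul_left (k ^ r)).of_nonneg_of_le (fun e => edgeDensity_nonneg hp hq ha e) hkle
  have h1 := le_energy_of_finite_energy hp hpq hqr ha hB H hks hkmass hkJ
  obtain ⟨e, he, hge⟩ := exists_grad_ne_zero hN hr hvs hv
  have h2 : ∑' e, edgeDensity p q a (fun x => k * v x) e <
      k ^ r * ∑' e, edgeDensity p q a v e := by
    rw [← tsum_mul_left]
    exact Summable.tsum_lt_tsum hkle
      (edgeDensity_mul_lt hk1 hp hq (by linarith) hqr ha he hge) hkJ (hvJa.mul_left _)
  rw [hkr] at h2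
  exact h1.trans_lt h2

/-- A nonzero pointwise limit of a minimizing sequence is a minimizer. Here the coefficients may
vary along the sequence, converging to `b ≥ a`. -/
lemma limit_is_minimizer (hN : 2 ≤ N) (hp : 0 < p) (hpq : p < q) (hqr : q ≤ r)
    (ha : ∀ x, 0 ≤ a x) (hab : ∀ x, a x ≤ b x) (hB : 0 < B)
    {F : Filter ℕ} [F.NeBot] {an un : ℕ → ZN N → ℝ} (han : ∀ n x, 0 ≤ an n x)
    (hanlim : ∀ x, Tendsto (fun n => an n x) F (𝓝 (b x)))
    (hun0 : ∀ n x, 0 ≤ un n x) (hfin : ∀ n, (Function.support (un n)).Finite)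
    (hmass : ∀ n, ∑' x, |un n x| ^ r = B)
    (henergy : Tendsto (fun n => ∑' e, edgeDensity p q (an n) (un n) e) F (𝓝 σ))
    (hunlim : ∀ x, Tendsto (fun n => un n x) F (𝓝 (v x))) (hv : ∃ x, v x ≠ 0)
    (H : ∀ w : ZN N → ℝ, (Function.support w).Finite → ∑' x, |w x| ^ r = B →
      σ ≤ ∑' e, edgeDensity p q a w e)
    (Hn : ∀ n, ∀ w : ZN N → ℝ, (Function.support w).Finite → ∑' x, |w x| ^ r = B →
      σ ≤ ∑' e, edgeDensity p q (an n) w e) :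
    (∀ x, 0 ≤ v x) ∧ Summable (fun x => |v x| ^ r) ∧ ∑' x, |v x| ^ r = B ∧
      Summable (edgeDensity p q a v) ∧ ∑' e, edgeDensity p q a v e = σ := by
  have hq : 0 < q := hp.trans hpq
  have hr : 0 < r := hq.trans_le hqr
  have hb : ∀ x, 0 ≤ b x := fun x => (ha x).trans (hab x)
  have hv0 : ∀ x, 0 ≤ v x := fun x => ge_of_tendsto' (hunlim x) fun n => hun0 n x
  have hσ : 0 ≤ σ := ge_of_tendsto' henergy fun n => tsum_nonneg fun e =>
    edgeDensity_nonneg hp hq (han n) e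
  have hunr : ∀ x, Tendsto (fun n => |un n x| ^ r) F (𝓝 (|v x| ^ r)) := fun x =>
    ((hunlim x).abs).rpow_const (Or.inr hr.le)
  have hunJ : ∀ e, Tendsto (fun n => edgeDensity p q (an n) (un n) e) F
      (𝓝 (edgeDensity p q b v e)) := tendsto_edgeDensity hp hq hanlim hunlim
  obtain ⟨hvs, hvB⟩ := summable_and_tsum_le_of_tendsto (F := F)
    (fn := fun n x => |un n x| ^ r) (f := fun x => |v x| ^ r) (Mn := fun _ => B)
    (fun n x => Real.rpow_nonneg (abs_nonneg _) _)
    (fun n => summable_abs_rpow_of_finite hr (hfin n)) (fun n => (hmass n).le)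
    tendsto_const_nhds hunr
  obtain ⟨hvJ, -⟩ := summable_and_tsum_le_of_tendsto (F := F)
    (fn := fun n => edgeDensity p q (an n) (un n)) (f := edgeDensity p q b v)
    (fun n e => edgeDensity_nonneg hp hq (han n) e)
    (fun n => summable_edgeDensity_of_finite hp hq (hfin n)) (fun n => le_rfl) henergy hunJ
  set s := ∑' x, |v x| ^ r with hs
  have hspos : 0 < s := by
    obtain ⟨x, hx⟩ := hv
    exact hvs.tsum_pos (fun x => Real.rpow_nonneg (abs_nonneg _) _) x
      (Real.rpow_pos_of_pos (abs_pos.2 hx) _)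
  have hvle : ∑' e, edgeDensity p q b v e ≤ s / B * σ := by
    have hlim := (tendsto_energy_min hp hq hb hv0 hvJ).const_add (s / B * σ)
    rw [add_zero] at hlim
    refine ge_of_tendsto hlim ?_
    filter_upwards [self_mem_nhdsWithin] with ε hε using
      energy_le_add_energy_min hp hpq hqr hb hB hσ han hanlim hfin hmass henergy hunlim hv0 hvs
        hvJ Hn hε
  have hvJa : Summable (edgeDensity p q a v) :=
    hvJ.of_nonneg_of_le (fun e => edgeDensity_nonneg hp hq ha e)
      fun e => edgeDensity_mono_coeff hq hab e
  have hJab : ∑' e, edgeDensity p q a v e ≤ ∑' e, edgeDensity p q b v e :=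
    hvJa.tsum_le_tsum (fun e => edgeDensity_mono_coeff hq hab e) hvJ
  have hsB : s = B := by
    by_contra hne
    have hlt : s < B := lt_of_le_of_ne hvB hne
    have h2 := lt_energy_of_mass_lt hN hp hpq hqr ha hv H hvs hvJa hspos hlt
    rw [← hs] at h2
    have h3 : B / s * ∑' e, edgeDensity p q a v e ≤ B / s * (s / B * σ) := by
      have := hJab.trans hvle
      gcongr
    have h4 : B / s * (s / B * σ) = σ := by field_simp
    linarith
  refine ⟨hv0, hvs, hsB, hvJa, le_antisymm ?_ ?_⟩
  · rw [hsB, div_self hB.ne', one_mul] at hvle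
    exact hJab.trans hvle
  · exact le_energy_of_finite_energy hp hpq hqr ha hB H hvs hsB hvJa

end Minimization
/-! ### The Euler–Lagrange equation and positivity -/

/-- The neighbours of a vertex. -/
def neighbors {N : ℕ} (x : ZN N) : Finset (ZN N) :=
  (Finset.Icc (fun i => x i - 1) (fun i => x i + 1)).filter (adj x)

lemma mem_neighbors {N : ℕ} {x y : ZN N} : y ∈ neighbors x ↔ adj x y := by
  simp only [neighbors, Finset.mem_filter, and_iff_right_iff_imp]
  exact adj_mem_Icc

lemma Lop_eq_sum {N : ℕ} (p q : ℝ) (a u : ZN N → ℝ) (x : ZN N) :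
    Lop p q a u x = -∑ y ∈ neighbors x, |u y - u x| ^ (p - 2) * (u y - u x) -
      ∑ y ∈ neighbors x, (a x + a y) / 2 * (|u y - u x| ^ (q - 2) * (u y - u x)) := by
  unfold Lop
  rw [tsum_eq_sum (s := neighbors x) fun y hy => if_neg fun h => hy (mem_neighbors.2 h),
    tsum_eq_sum (s := neighbors x) fun y hy => if_neg fun h => hy (mem_neighbors.2 h)]
  congr 1
  · congr 1
    exact Finset.sum_congr rfl fun y hy => if_pos (mem_neighbors.1 hy)
  · exact Finset.sum_congr rfl fun y hy => if_pos (mem_neighbors.1 hy)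

section EulerLagrange

variable {N : ℕ} {s p q r B : ℝ} {a c u : ZN N → ℝ}

lemma hasSum_edgeTerm_update (hc : Summable (edgeTerm s c u)) (x₀ : ZN N) (h : ℝ) :
    HasSum (edgeTerm s c (Function.update u x₀ (u x₀ + h)))
      (∑' e, edgeTerm s c u e + ∑ y ∈ neighbors x₀,
        (c x₀ + c y) * (|u y - u x₀ - h| ^ s - |u y - u x₀| ^ s)) := by
  set v := Function.update u x₀ (u x₀ + h) with hv
  let K₁ := (neighbors x₀).image fun y => (x₀, y)
  let K₂ := (neighbors x₀).image fun y => (y, x₀)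
  have hoff : ∀ e ∉ K₁ ∪ K₂, edgeTerm s c v e - edgeTerm s c u e = 0 := by
    rintro ⟨x, y⟩ he
    rw [sub_eq_zero]
    by_cases hadj : adj x y
    · refine edgeTerm_congr ?_
      have hx : x ≠ x₀ := by
        rintro rfl
        exact he (Finset.mem_union_left _
          (Finset.mem_image.2 ⟨y, mem_neighbors.2 hadj, rfl⟩))
      have hy : y ≠ x₀ := by
        rintro rfl
        exact he (Finset.mem_union_right _
          (Finset.mem_image.2 ⟨x, mem_neighbors.2 (adj_symm hadj), rfl⟩))
      simp [grad, hv, hx, hy]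
    · simp [edgeTerm, hadj]
  have hdisj : Disjoint K₁ K₂ := by
    rw [Finset.disjoint_left]
    rintro ⟨x, y⟩ h1 h2
    simp only [K₁, K₂, Finset.mem_image, Prod.mk.injEq, mem_neighbors] at h1 h2
    obtain ⟨z, hz, rfl, rfl⟩ := h1
    obtain ⟨z', hz', rfl, hz''⟩ := h2
    exact adj_ne hz hz''
  have hsum := hasSum_sum_of_ne_finset_zero (L := SummationFilter.unconditional _) hoff
  have hval : ∑ e ∈ K₁ ∪ K₂, (edgeTerm s c v e - edgeTerm s c u e) =
      ∑ y ∈ neighbors x₀, (c x₀ + c y) * (|u y - u x₀ - h| ^ s - |u y - u x₀| ^ s) := by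
    rw [Finset.sum_union hdisj, Finset.sum_image fun _ _ _ _ h => (Prod.ext_iff.1 h).2,
      Finset.sum_image fun _ _ _ _ h => (Prod.ext_iff.1 h).1, ← Finset.sum_add_distrib]
    refine Finset.sum_congr rfl fun y hy => ?_
    have hadj := mem_neighbors.1 hy
    have hne : y ≠ x₀ := (adj_ne hadj).symm
    simp only [edgeTerm, grad, if_pos hadj, if_pos (adj_symm hadj), hv,
      Function.update_self, Function.update_of_ne hne]
    rw [abs_sub_comm (u x₀ + h) (u y), abs_sub_comm (u x₀) (u y), sub_sub]
    ring
  rw [hval] at hsum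
  simpa using hc.hasSum.add hsum

lemma hasDerivAt_sum_abs_rpow (hs : 1 < s) (x₀ : ZN N) :
    HasDerivAt (fun h => ∑ y ∈ neighbors x₀,
        (c x₀ + c y) * (|u y - u x₀ - h| ^ s - |u y - u x₀| ^ s))
      (-∑ y ∈ neighbors x₀, (c x₀ + c y) * s * (|u y - u x₀| ^ (s - 2) * (u y - u x₀))) 0 := by
  rw [← Finset.sum_neg_distrib]
  refine HasDerivAt.fun_sum fun y _ => ?_
  have h1 : HasDerivAt (fun h : ℝ => u y - u x₀ - h) (-1) 0 := by
    simpa using (hasDerivAt_id (0 : ℝ)).const_sub (u y - u x₀)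
  have h2 := (hasDerivAt_abs_rpow (u y - u x₀ - 0) hs).comp (0 : ℝ) h1
  have h3 := ((h2.sub_const (|u y - u x₀| ^ s)).const_mul (c x₀ + c y))
  refine h3.congr_deriv ?_
  rw [sub_zero]
  ring

lemma summable_edgeTerm_left (hq : 0 < q) (hp : 0 < p) (ha : ∀ x, 0 ≤ a x)
    (hJ : Summable (edgeDensity p q a u)) : Summable (edgeTerm p (fun _ => 1 / p) u) :=
  hJ.of_nonneg_of_le (fun e => edgeTerm_nonneg (fun _ => by positivity) e) fun e =>
    le_add_of_nonneg_right (edgeTerm_nonneg (fun x => div_nonneg (ha x) hq.le) e)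

lemma summable_edgeTerm_right (hq : 0 < q) (hp : 0 < p) (ha : ∀ x, 0 ≤ a x)
    (hJ : Summable (edgeDensity p q a u)) : Summable (edgeTerm q (fun x => a x / q) u) :=
  hJ.of_nonneg_of_le (fun e => edgeTerm_nonneg (fun x => div_nonneg (ha x) hq.le) e) fun e =>
    le_add_of_nonneg_left (edgeTerm_nonneg (fun _ => by positivity) e)

lemma hasSum_abs_update (hus : Summable fun x => |u x| ^ r) (x₀ : ZN N) (h : ℝ) :
    HasSum (fun x => |Function.update u x₀ (u x₀ + h) x| ^ r)
      (∑' x, |u x| ^ r + (|u x₀ + h| ^ r - |u x₀| ^ r)) := by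
  have h1 := hasSum_ite_eq (L := SummationFilter.unconditional _) x₀ (|u x₀ + h| ^ r - |u x₀| ^ r)
  refine (hus.hasSum.add h1).congr_fun fun x => ?_
  by_cases hx : x = x₀
  · subst hx; simp
  · simp [hx]

/-- The Euler–Lagrange equation of a nonnegative constrained minimizer. -/
lemma euler_lagrange (hp : 1 < p) (hpq : p < q) (hr : 1 < r) (ha : ∀ x, 0 ≤ a x) (hB : 0 < B)
    (hu0 : ∀ x, 0 ≤ u x) (hus : Summable fun x => |u x| ^ r) (huB : ∑' x, |u x| ^ r = B)
    (hJ : Summable (edgeDensity p q a u))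
    (hmin : ∀ v : ZN N → ℝ, Summable (fun x => |v x| ^ r) → ∑' x, |v x| ^ r = B →
      Summable (edgeDensity p q a v) →
      ∑' e, edgeDensity p q a u e ≤ ∑' e, edgeDensity p q a v e) (x₀ : ZN N) :
    Lop p q a u x₀ = (p * ∑' e, edgeTerm p (fun _ => 1 / p) u e +
      q * ∑' e, edgeTerm q (fun x => a x / q) u e) / (2 * B) * u x₀ ^ (r - 1) := by
  have hp0 : 0 < p := by linarith
  have hq0 : 0 < q := by linarith
  have hr0 : 0 < r := by linarith
  have hsp := summable_edgeTerm_left hq0 hp0 ha hJ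
  have hsq := summable_edgeTerm_right hq0 hp0 ha hJ
  set P := ∑' e, edgeTerm p (fun _ => 1 / p) u e with hP
  set Q := ∑' e, edgeTerm q (fun x => a x / q) u e with hQ
  let φ : ℝ → ℝ := fun h => ∑ y ∈ neighbors x₀,
    (1 / p + 1 / p) * (|u y - u x₀ - h| ^ p - |u y - u x₀| ^ p)
  let ψ : ℝ → ℝ := fun h => ∑ y ∈ neighbors x₀,
    (a x₀ / q + a y / q) * (|u y - u x₀ - h| ^ q - |u y - u x₀| ^ q)
  let M : ℝ → ℝ := fun h => (B + (|u x₀ + h| ^ r - |u x₀| ^ r)) / B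
  have hM0 : M 0 = 1 := by simp [M, hB.ne']
  have hφ0 : φ 0 = 0 := by simp [φ]
  have hψ0 : ψ 0 = 0 := by simp [ψ]
  have hMd : HasDerivAt M (r * u x₀ ^ (r - 1) / B) 0 := by
    have h1 : HasDerivAt (fun h : ℝ => u x₀ + h) 1 0 := (hasDerivAt_id (0 : ℝ)).const_add (u x₀)
    have h2 := (hasDerivAt_abs_rpow (u x₀ + 0) hr).comp (0 : ℝ) h1
    have h3 := ((h2.sub_const (|u x₀| ^ r)).const_add B).div_const B
    refine h3.congr_deriv ?_
    rw [add_zero, mul_one, abs_of_nonneg (hu0 x₀)]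
    rcases (hu0 x₀).eq_or_lt with h0 | hpos
    · rw [← h0, Real.zero_rpow (show r - 1 ≠ 0 by linarith)]
      simp
    · rw [mul_assoc, ← Real.rpow_add_one hpos.ne']
      congr 3
      ring
  let G : ℝ → ℝ := fun h => M h ^ (-(p / r)) * (P + φ h) + M h ^ (-(q / r)) * (Q + ψ h)
  have hGmin : IsLocalMin G 0 := by
    have hMpos : ∀ᶠ h in 𝓝 (0 : ℝ), 0 < M h :=
      hMd.continuousAt.eventually_const_lt (by rw [hM0]; exact one_pos)
    filter_upwards [hMpos] with h hMh
    set v := Function.update u x₀ (u x₀ + h) with hv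
    set k := M h ^ (-(1 / r)) with hk
    have hk0 : 0 ≤ k := Real.rpow_nonneg hMh.le _
    have hkpow : ∀ s : ℝ, k ^ s = M h ^ (-(s / r)) := fun s => by
      rw [hk, ← Real.rpow_mul hMh.le]
      congr 1
      ring
    have hvs := hasSum_abs_update hus x₀ h
    have hvp := hasSum_edgeTerm_update hsp x₀ h
    have hvq := hasSum_edgeTerm_update hsq x₀ h
    have hkv : Summable fun x => |k * v x| ^ r := by
      refine (hvs.summable.mul_left (k ^ r)).congr fun x => ?_
      rw [abs_mul, abs_of_nonneg hk0, Real.mul_rpow hk0 (abs_nonneg _)]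
    have hkvB : ∑' x, |k * v x| ^ r = B := by
      rw [tsum_abs_mul_rpow hk0, hvs.tsum_eq, huB, hkpow, div_self hr0.ne', Real.rpow_neg_one]
      have : B + (|u x₀ + h| ^ r - |u x₀| ^ r) = M h * B := by
        simp only [M]
        field_simp
      rw [this]
      field_simp
    have hkJ : HasSum (edgeDensity p q a fun x => k * v x) (G h) := by
      have := (hvp.mul_left (k ^ p)).add (hvq.mul_left (k ^ q))
      rw [hkpow, hkpow] at this
      refine this.congr_fun fun e => ?_
      simp only [edgeDensity, edgeTerm_mul hk0, hkpow, hv]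
    have := hmin _ hkv hkvB hkJ.summable
    rw [hkJ.tsum_eq] at this
    have hG0 : G 0 = ∑' e, edgeDensity p q a u e := by
      simp only [G, hM0, hφ0, hψ0, Real.one_rpow, one_mul, add_zero]
      exact (hsp.tsum_add hsq).symm
    rwa [hG0]
  have hφd : HasDerivAt φ _ 0 := hasDerivAt_sum_abs_rpow (c := fun _ => 1 / p) (u := u) hp x₀
  have hψd : HasDerivAt ψ _ 0 :=
    hasDerivAt_sum_abs_rpow (c := fun x => a x / q) (u := u) (hp.trans hpq) x₀
  have hM1 : M 0 ≠ 0 := by rw [hM0]; exact one_ne_zero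
  have hGd := ((hMd.rpow_const (p := -(p / r)) (Or.inl hM1)).mul (hφd.const_add P)).add
    ((hMd.rpow_const (p := -(q / r)) (Or.inl hM1)).mul (hψd.const_add Q))
  have hzero := hGmin.hasDerivAt_eq_zero hGd
  simp only [hM0, hφ0, hψ0, Real.one_rpow, mul_one, one_mul, add_zero] at hzero
  rw [Lop_eq_sum]
  have e1 : ∑ y ∈ neighbors x₀, (1 / p + 1 / p) * p * (|u y - u x₀| ^ (p - 2) * (u y - u x₀)) =
      2 * ∑ y ∈ neighbors x₀, |u y - u x₀| ^ (p - 2) * (u y - u x₀) := by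
    rw [Finset.mul_sum]
    refine Finset.sum_congr rfl fun y _ => ?_
    field_simp
    ring
  have e2 : ∑ y ∈ neighbors x₀,
        (a x₀ / q + a y / q) * q * (|u y - u x₀| ^ (q - 2) * (u y - u x₀)) =
      2 * ∑ y ∈ neighbors x₀, (a x₀ + a y) / 2 * (|u y - u x₀| ^ (q - 2) * (u y - u x₀)) := by
    rw [Finset.mul_sum]
    refine Finset.sum_congr rfl fun y _ => ?_
    field_simp
  rw [e1, e2] at hzero
  have e3 : r * u x₀ ^ (r - 1) / B * -(p / r) * P = -(p * P / B * u x₀ ^ (r - 1)) := by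
    field_simp
  have e4 : r * u x₀ ^ (r - 1) / B * -(q / r) * Q = -(q * Q / B * u x₀ ^ (r - 1)) := by
    field_simp
  rw [e3, e4] at hzero
  have e5 : (p * P + q * Q) / (2 * B) * u x₀ ^ (r - 1) =
      (p * P / B * u x₀ ^ (r - 1) + q * Q / B * u x₀ ^ (r - 1)) / 2 := by
    field_simp
  rw [e5]
  linarith

/-- The strong maximum principle. -/
lemma pos_of_Lop_eq (hr : 1 < r) (ha : ∀ x, 0 ≤ a x) (hu0 : ∀ x, 0 ≤ u x)
    (hne : ∃ x, u x ≠ 0) {lam : ℝ} (hL : ∀ x, Lop p q a u x = lam * u x ^ (r - 1)) (x : ZN N) :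
    0 < u x := by
  refine lt_of_le_of_ne (hu0 x) fun h0 => ?_
  obtain ⟨z, hz⟩ := hne
  refine hz (adj_induction (P := fun x => u x = 0) h0.symm (fun x y hxy hx => ?_) z)
  have h1 := hL x
  rw [hx, Real.zero_rpow (by linarith), mul_zero, Lop_eq_sum, hx] at h1
  simp only [sub_zero] at h1
  have hn1 : ∀ y ∈ neighbors x, 0 ≤ |u y| ^ (p - 2) * u y := fun y _ =>
    mul_nonneg (Real.rpow_nonneg (abs_nonneg _) _) (hu0 y)
  have hn2 : 0 ≤ ∑ y ∈ neighbors x, (a x + a y) / 2 * (|u y| ^ (q - 2) * u y) :=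
    Finset.sum_nonneg fun y _ => mul_nonneg (by have := ha x; have := ha y; positivity)
      (mul_nonneg (Real.rpow_nonneg (abs_nonneg _) _) (hu0 y))
  have hs := Finset.sum_nonneg hn1
  have hzero := (Finset.sum_eq_zero_iff_of_nonneg hn1).1 (by linarith) y (mem_neighbors.2 hxy)
  by_contra hy
  rcases mul_eq_zero.1 hzero with h | h
  · exact (Real.rpow_pos_of_pos (abs_pos.2 hy) _).ne' h
  · exact hy h

end EulerLagrange
/-! ### Existence of minimizers -/

section Existence

variable {N : ℕ} {p q r B σ : ℝ} {a u : ZN N → ℝ}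

lemma tsum_edgeDensity_translate (z : ZN N) :
    ∑' e, edgeDensity p q (fun x => a (x + z)) (fun x => u (x + z)) e =
      ∑' e, edgeDensity p q a u e := by
  rw [← (Equiv.addRight ((z, z) : ZN N × ZN N)).tsum_eq (edgeDensity p q a u)]
  refine tsum_congr fun e => ?_
  simp only [edgeDensity, edgeTerm, grad, Equiv.coe_addRight, Prod.fst_add, Prod.snd_add,
    adj_translate]

lemma tsum_abs_translate (z : ZN N) : ∑' x, |u (x + z)| ^ r = ∑' x, |u x| ^ r :=
  (Equiv.addRight z).tsum_eq fun x => |u x| ^ r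

lemma finite_support_translate (z : ZN N) (hu : (Function.support u).Finite) :
    (Function.support fun x => u (x + z)).Finite :=
  Set.Finite.preimage (f := fun x : ZN N => x + z) (add_left_injective z).injOn hu

lemma periodic_add {T : ℕ} (hT : ∀ (x : ZN N) (i : Fin N), a (x + (T : ℤ) • Pi.single i 1) = a x)
    (x k : ZN N) : a (x + (T : ℤ) • k) = a x := by
  have line : ∀ (i : Fin N) (m : ℤ) (y : ZN N), a (y + (T : ℤ) • Pi.single i m) = a y := by
    intro i m
    induction m using Int.induction_on with
    | zero => intro y; simp
    | succ m ih =>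
      intro y
      rw [Pi.single_add, smul_add, ← add_assoc, hT, ih]
    | pred m ih =>
      intro y
      have := hT (y + (T : ℤ) • Pi.single i (-(m : ℤ) - 1)) i
      rw [add_assoc, ← smul_add, ← Pi.single_add, sub_add_cancel, ih] at this
      exact this.symm
  have main : ∀ s : Finset (Fin N), a (x + (T : ℤ) • ∑ i ∈ s, Pi.single i (k i)) = a x := by
    intro s
    induction s using Finset.induction_on with
    | empty => simp
    | insert i s hi ih =>
      rw [Finset.sum_insert hi, add_comm (Pi.single i _), smul_add, ← add_assoc, line, ih]
  have := main Finset.univ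
  rwa [Finset.univ_sum_single] at this

/-- Recentering a sequence of vertices by translations along which the coefficient converges to a
function above it. -/
lemma exists_recentering
    (hper : (∃ T : ℕ, 0 < T ∧ ∀ (x : ZN N) (i : Fin N),
        a (x + (T : ℤ) • Pi.single i 1) = a x) ∨
      (∃ aInf : ℝ, Tendsto a cofinite (𝓝 aInf) ∧ ∀ x, a x ≤ aInf))
    (F : Ultrafilter ℕ) (xs : ℕ → ZN N) :
    ∃ (z : ℕ → ZN N) (b : ZN N → ℝ) (x₀ : ZN N), (∀ x, a x ≤ b x) ∧
      (∀ x, Tendsto (fun n => a (x + z n)) F (𝓝 (b x))) ∧ ∀ᶠ n in F, x₀ + z n = xs n := by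
  rcases hper with ⟨T, hT, hper⟩ | ⟨aInf, hlim, hle⟩
  · let ys : ℕ → ZN N := fun n i => xs n i % T
    have hys : ∀ n, ys n ∈ Set.Icc (0 : ZN N) (fun _ => (T : ℤ)) := fun n =>
      ⟨fun i => Int.emod_nonneg _ (by omega), fun i => (Int.emod_lt_of_pos _ (by omega)).le⟩
    refine ⟨fun n => (T : ℤ) • fun i => xs n i / T, a, ?_⟩
    rcases (F.map ys).le_cofinite_or_eq_pure with h | ⟨y, hy⟩
    · have h1 : ∀ᶠ y in (F.map ys : Filter (ZN N)), y ∉ Set.Icc (0 : ZN N) (fun _ => (T : ℤ)) :=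
        h (Set.finite_Icc _ _).compl_mem_cofinite
      rw [Ultrafilter.coe_map, eventually_map] at h1
      obtain ⟨n, hn⟩ := h1.exists
      exact absurd (hys n) hn
    · have h1 : ∀ᶠ y' in (F.map ys : Filter (ZN N)), y' = y := by
        rw [hy]
        exact eventually_pure.2 rfl
      rw [Ultrafilter.coe_map, eventually_map] at h1
      refine ⟨y, fun x => le_rfl, fun x => ?_, ?_⟩
      · simp only [periodic_add hper]
        exact tendsto_const_nhds
      · filter_upwards [h1] with n hn
        rw [← hn]
        ext i
        exact Int.emod_add_mul_ediv _ _
  · rcases (F.map xs).le_cofinite_or_eq_pure with h | ⟨y, hy⟩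
    · refine ⟨xs, fun _ => aInf, 0, hle, fun x => ?_, Eventually.of_forall fun n => zero_add _⟩
      have h1 : Tendsto xs F cofinite := h
      exact hlim.comp ((add_right_injective x).tendsto_cofinite.comp h1)
    · have h1 : ∀ᶠ y' in (F.map xs : Filter (ZN N)), y' = y := by
        rw [hy]
        exact eventually_pure.2 rfl
      rw [Ultrafilter.coe_map, eventually_map] at h1
      refine ⟨fun _ => 0, a, y, fun x => le_rfl, fun x => ?_, ?_⟩
      · simp only [add_zero]
        exact tendsto_const_nhds
      · filter_upwards [h1] with n hn
        rw [hn, add_zero]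

lemma exists_minimizer (hN : 2 ≤ N) (hp : 1 < p) (hpN : p < (N : ℝ)) (hpq : p < q)
    (hr : (N : ℝ) * p / ((N : ℝ) - p) < r) (hqr : q ≤ r) (ha : ∀ x, 0 ≤ a x)
    (hper : (∃ T : ℕ, 0 < T ∧ ∀ (x : ZN N) (i : Fin N),
        a (x + (T : ℤ) • Pi.single i 1) = a x) ∨
      (∃ aInf : ℝ, Tendsto a cofinite (𝓝 aInf) ∧ ∀ x, a x ≤ aInf))
    (hB : 0 < B) {un : ℕ → ZN N → ℝ} (hun0 : ∀ n x, 0 ≤ un n x)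
    (hfin : ∀ n, (Function.support (un n)).Finite) (hmass : ∀ n, ∑' x, |un n x| ^ r = B)
    (henergy : Tendsto (fun n => ∑' e, edgeDensity p q a (un n) e) atTop (𝓝 σ))
    (H : ∀ w : ZN N → ℝ, (Function.support w).Finite → ∑' x, |w x| ^ r = B →
      σ ≤ ∑' e, edgeDensity p q a w e) :
    ∃ v : ZN N → ℝ, (∀ x, 0 ≤ v x) ∧ (∃ x, v x ≠ 0) ∧ Summable (fun x => |v x| ^ r) ∧
      ∑' x, |v x| ^ r = B ∧ Summable (edgeDensity p q a v) ∧
      ∑' e, edgeDensity p q a v e = σ := by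
  have hp0 : 0 < p := by linarith
  have hq0 : 0 < q := by linarith
  have hr0 : 0 < r := by linarith
  obtain ⟨E, hE⟩ := henergy.bddAbove_range
  obtain ⟨δ, hδ, hlow⟩ := exists_le_abs_of_bounded_energy (E := p * E) hN hp hpN hr hB
  have hpoint : ∀ n, ∃ x, δ ≤ |un n x| := fun n => by
    refine hlow (un n) (hfin n) ?_ ?_
    · rw [← hmass n, ENNReal.ofReal_tsum_of_nonneg
        (fun x => Real.rpow_nonneg (abs_nonneg _) _) (summable_abs_rpow_of_finite hr0 (hfin n))]
    · have hs := summable_edgeDensity_of_finite (a := a) hp0 hq0 (hfin n)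
      have hle : ∀ e, edgeTerm p (fun _ => 1) (un n) e ≤ p * edgeDensity p q a (un n) e := by
        intro e
        have h1 : edgeTerm p (fun _ => 1) (un n) e = p * edgeTerm p (fun _ => 1 / p) (un n) e := by
          unfold edgeTerm
          split_ifs
          · field_simp
          · simp
        rw [h1]
        refine mul_le_mul_of_nonneg_left ?_ hp0.le
        exact le_add_of_nonneg_right (edgeTerm_nonneg (fun x => div_nonneg (ha x) hq0.le) e)
      calc _ ≤ ∑' e, ENNReal.ofReal (p * edgeDensity p q a (un n) e) :=
            ENNReal.tsum_le_tsum fun e => ENNReal.ofReal_le_ofReal (hle e)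
        _ = ENNReal.ofReal (p * ∑' e, edgeDensity p q a (un n) e) := by
            rw [← tsum_mul_left, ENNReal.ofReal_tsum_of_nonneg
              (fun e => mul_nonneg hp0.le (edgeDensity_nonneg hp0 hq0 ha e)) (hs.mul_left p)]
        _ ≤ _ := ENNReal.ofReal_le_ofReal
            (mul_le_mul_of_nonneg_left (hE (Set.mem_range_self n)) hp0.le)
  choose xs hxs using hpoint
  let F : Ultrafilter ℕ := hyperfilter ℕ
  obtain ⟨z, b, x₀, hab, hblim, hx₀⟩ := exists_recentering hper F xs
  have hbound : ∀ n x, un n x ∈ Set.Icc 0 (B ^ (1 / r)) := by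
    intro n x
    refine ⟨hun0 n x, ?_⟩
    have h1 : |un n x| ^ r ≤ B := by
      rw [← hmass n]
      exact (summable_abs_rpow_of_finite hr0 (hfin n)).le_tsum x
        fun y _ => Real.rpow_nonneg (abs_nonneg _) _
    rw [abs_of_nonneg (hun0 n x)] at h1
    rwa [one_div, Real.le_rpow_inv_iff_of_pos (hun0 n x) hB.le hr0]
  have hlim : ∀ x, ∃ l, Tendsto (fun n => un n (x + z n)) F (𝓝 l) := by
    intro x
    obtain ⟨l, -, hl⟩ := isCompact_Icc.ultrafilter_le_nhds (F.map fun n => un n (x + z n))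
      (by
        rw [le_principal_iff, Ultrafilter.coe_map, mem_map]
        exact Eventually.of_forall fun n => hbound n _)
    exact ⟨l, hl⟩
  choose v hv using hlim
  have hvne : v x₀ ≠ 0 := by
    have h1 : δ ≤ v x₀ := by
      refine ge_of_tendsto (hv x₀) ?_
      filter_upwards [hx₀] with n hn
      have := hxs n
      rwa [abs_of_nonneg (hun0 n _), ← hn] at this
    exact (hδ.trans_le h1).ne'
  obtain ⟨h1, h2, h3, h4, h5⟩ := limit_is_minimizer (F := (F : Filter ℕ)) (v := v) (σ := σ)
    (an := fun n x => a (x + z n)) (un := fun n x => un n (x + z n)) hN hp0 hpq hqr ha hab hB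
    (fun n x => ha _) hblim (fun n x => hun0 n _)
    (fun n => finite_support_translate (z n) (hfin n))
    (fun n => (tsum_abs_translate (u := un n) (z n)).trans (hmass n))
    (by
      simp only [tsum_edgeDensity_translate]
      exact henergy.mono_left Nat.hyperfilter_le_atTop)
    hv ⟨x₀, hvne⟩ H
    (fun n w hw hwB => by
      have h := H (fun x => w (x + -z n)) (finite_support_translate (-z n) hw)
        ((tsum_abs_translate (-z n)).trans hwB)
      rw [← tsum_edgeDensity_translate (z n)] at h
      simpa only [add_neg_cancel_right] using h)
  exact ⟨v, h1, ⟨x₀, hvne⟩, h2, h3, h4, h5⟩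

/-! ### Passage to extended nonnegative reals -/

lemma energy_eq_tsum (p q : ℝ) (a u : ZN N → ℝ) :
    energy p q a u = (∑' e, ENNReal.ofReal (edgeDensity p q a u e)) / 2 := by
  unfold energy eInt
  congr 1
  refine tsum_congr fun e => ?_
  unfold edgeDensity edgeTerm
  split_ifs
  · rfl
  · simp

lemma energy_eq_ofReal (hp : 0 < p) (hq : 0 < q) (ha : ∀ x, 0 ≤ a x)
    (hJ : Summable (edgeDensity p q a u)) :
    energy p q a u = ENNReal.ofReal ((∑' e, edgeDensity p q a u e) / 2) := by
  rw [energy_eq_tsum, ← ENNReal.ofReal_tsum_of_nonneg (edgeDensity_nonneg hp hq ha) hJ,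
    ENNReal.ofReal_div_of_pos two_pos]
  simp

lemma vsum_eq_ofReal (hus : Summable fun x => |u x| ^ r) :
    vsum r u = ENNReal.ofReal (∑' x, |u x| ^ r) :=
  (ENNReal.ofReal_tsum_of_nonneg (fun _ => Real.rpow_nonneg (abs_nonneg _) _) hus).symm

lemma vsum_eq_ofReal_iff (hr : 0 < r) (hB : 0 < B) (hu : (Function.support u).Finite) :
    vsum r u = ENNReal.ofReal B ↔ ∑' x, |u x| ^ r = B := by
  rw [vsum_eq_ofReal (summable_abs_rpow_of_finite hr hu), ENNReal.ofReal_eq_ofReal_iff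
    (tsum_nonneg fun _ => Real.rpow_nonneg (abs_nonneg _) _) hB.le]

lemma exists_finite_support_mass_eq (hr : 0 < r) (hB : 0 < B) :
    ∃ w : ZN N → ℝ, (Function.support w).Finite ∧ ∑' x, |w x| ^ r = B := by
  refine ⟨Pi.single 0 (B ^ (1 / r)), (Set.finite_singleton (0 : ZN N)).subset
    Pi.support_single_subset, ?_⟩
  rw [tsum_eq_single 0 fun x hx => by
    rw [Pi.single_eq_of_ne hx, abs_zero, Real.zero_rpow hr.ne']]
  rw [Pi.single_eq_same, abs_of_nonneg (Real.rpow_nonneg hB.le _), rpow_inv_rpow_cancel hB.le hr]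

lemma Slevel_ne_top (hp : 0 < p) (hq : 0 < q) (ha : ∀ x, 0 ≤ a x) (hr : 0 < r) {t : ℝ}
    (ht : 0 < r * t) : Slevel p q a r t ≠ ⊤ := by
  obtain ⟨w, hw, hwB⟩ := exists_finite_support_mass_eq (N := N) hr ht
  refine ne_top_of_le_ne_top ?_ (sInf_le ⟨w, hw, (vsum_eq_ofReal_iff hr ht hw).2 hwB, rfl⟩)
  rw [energy_eq_ofReal hp hq ha (summable_edgeDensity_of_finite hp hq hw)]
  exact ENNReal.ofReal_ne_top

lemma Slevel_le (hp : 0 < p) (hq : 0 < q) (ha : ∀ x, 0 ≤ a x) (hr : 0 < r) {t : ℝ}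
    (ht : 0 < r * t) {w : ZN N → ℝ} (hw : (Function.support w).Finite)
    (hwB : ∑' x, |w x| ^ r = r * t) :
    2 * (Slevel p q a r t).toReal ≤ ∑' e, edgeDensity p q a w e := by
  have hle : Slevel p q a r t ≤ energy p q a w :=
    sInf_le ⟨w, hw, (vsum_eq_ofReal_iff hr ht hw).2 hwB, rfl⟩
  rw [energy_eq_ofReal hp hq ha (summable_edgeDensity_of_finite hp hq hw)] at hle
  have h0 : 0 ≤ ∑' e, edgeDensity p q a w e := tsum_nonneg (edgeDensity_nonneg hp hq ha)
  have := ENNReal.toReal_le_of_le_ofReal (by linarith) hle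
  linarith

/-- A nonnegative minimizing sequence for the constrained problem. -/
lemma exists_minimizing_seq (hp : 0 < p) (hq : 0 < q) (ha : ∀ x, 0 ≤ a x) (hr : 0 < r) {t : ℝ}
    (ht : 0 < r * t) :
    ∃ un : ℕ → ZN N → ℝ, (∀ n x, 0 ≤ un n x) ∧ (∀ n, (Function.support (un n)).Finite) ∧
      (∀ n, ∑' x, |un n x| ^ r = r * t) ∧
      Tendsto (fun n => ∑' e, edgeDensity p q a (un n) e) atTop
        (𝓝 (2 * (Slevel p q a r t).toReal)) := by
  obtain ⟨w₀, hw₀, hw₀B⟩ := exists_finite_support_mass_eq (N := N) hr ht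
  have hne : { c : ℝ≥0∞ | ∃ u : ZN N → ℝ, (Function.support u).Finite ∧
      vsum r u = ENNReal.ofReal (r * t) ∧ energy p q a u = c }.Nonempty :=
    ⟨_, w₀, hw₀, (vsum_eq_ofReal_iff hr ht hw₀).2 hw₀B, rfl⟩
  obtain ⟨cs, -, hclim, hcs⟩ := exists_seq_tendsto_sInf hne (OrderBot.bddBelow _)
  choose w hw hwB hwc using hcs
  have hfin : ∀ n, (Function.support fun x => |w n x|).Finite := fun n =>
    (hw n).subset fun x hx => abs_ne_zero.1 hx
  have hmass : ∀ n, ∑' x, |(|w n x|)| ^ r = r * t := fun n => by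
    simp only [abs_abs]
    exact (vsum_eq_ofReal_iff hr ht (hw n)).1 (hwB n)
  refine ⟨fun n x => |w n x|, fun n x => abs_nonneg _, hfin, hmass, ?_⟩
  have hupper : Tendsto (fun n => 2 * (cs n).toReal) atTop
      (𝓝 (2 * (Slevel p q a r t).toReal)) :=
    ((ENNReal.tendsto_toReal (Slevel_ne_top hp hq ha hr ht)).comp hclim).const_mul 2
  refine tendsto_of_tendsto_of_tendsto_of_le_of_le tendsto_const_nhds hupper
    (fun n => Slevel_le hp hq ha hr ht (hfin n) (hmass n)) fun n => ?_
  have h0 : 0 ≤ ∑' e, edgeDensity p q a (w n) e := tsum_nonneg (edgeDensity_nonneg hp hq ha)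
  have hws := summable_edgeDensity_of_finite (a := a) hp hq (hw n)
  simp only [← hwc n, energy_eq_ofReal hp hq ha hws]
  rw [ENNReal.toReal_ofReal (by linarith), mul_div_cancel₀ _ two_ne_zero]
  exact (summable_edgeDensity_of_finite hp hq (hfin n)).tsum_le_tsum
    (fun e => edgeDensity_mono hp hq ha (abs_abs_sub_abs_le_abs_sub _ _)) hws

end Existence

/-- existence of a positive solution to the constrained minimization problem
(and the associated eigenvalue problem) when `a` is `T`-periodic or a bounded potential. -/
theorem statement3 {N : ℕ} (hN : 2 ≤ N) (p q : ℝ) (hp : 1 < p) (hpN : p < (N : ℝ))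
    (hpq : p < q) (pstar : ℝ) (hpstar : pstar = (N : ℝ) * p / ((N : ℝ) - p))
    (r : ℝ) (hr : pstar < r) (hrq : q ≤ r)
    (a : ZN N → ℝ) (ha : ∀ x, 0 ≤ a x)
    (hper : (∃ T : ℕ, 0 < T ∧ ∀ (x : ZN N) (i : Fin N),
        a (x + (T : ℤ) • Pi.single i 1) = a x) ∨
      (∃ aInf : ℝ, Tendsto a cofinite (𝓝 aInf) ∧ ∀ x, a x ≤ aInf)) :
    ∀ t : ℝ, 0 < t → ∃ (u : ZN N → ℝ) (lam : ℝ), 0 < lam ∧ (∀ x, 0 < u x) ∧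
      vsum r u = ENNReal.ofReal (r * t) ∧
      energy p q a u = Slevel p q a r t ∧
      ∀ x₀ : ZN N, Lop p q a u x₀ = lam * (u x₀) ^ (r - 1) := by
  intro t ht
  subst hpstar
  have hp0 : 0 < p := by linarith
  have hq0 : 0 < q := by linarith
  have hr1 : 1 < r := by linarith
  have hr0 : 0 < r := by linarith
  have hB : 0 < r * t := mul_pos hr0 ht
  have hS := Slevel_ne_top hp0 hq0 ha hr0 hB
  obtain ⟨un, hun0, hfin, hmass, hlim⟩ := exists_minimizing_seq hp0 hq0 ha hr0 hB
  have H := fun w hw hwB => Slevel_le (w := w) hp0 hq0 ha hr0 hB hw hwB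
  obtain ⟨u, hu0, hune, hus, huB, huJ, huσ⟩ :=
    exists_minimizer hN hp hpN hpq hr hrq ha hper hB hun0 hfin hmass hlim H
  have hEL := euler_lagrange hp hpq hr1 ha hB hu0 hus huB huJ fun v hvs hvB hvJ => by
    rw [huσ]
    exact le_energy_of_finite_energy hp0 hpq hrq ha hB H hvs hvB hvJ
  refine ⟨u, _, ?_, pos_of_Lop_eq hr1 ha hu0 hune hEL, ?_, ?_, hEL⟩
  · obtain ⟨e, he, hge⟩ := exists_grad_ne_zero hN hr0 hus hune
    have hP : 0 < ∑' e, edgeTerm p (fun _ => 1 / p) u e := by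
      refine (summable_edgeTerm_left hq0 hp0 ha huJ).tsum_pos
        (fun e => edgeTerm_nonneg (fun _ => by positivity) e) e ?_
      unfold edgeTerm
      rw [if_pos he]
      have := Real.rpow_pos_of_pos (abs_pos.2 hge) p
      positivity
    have hQ : 0 ≤ ∑' e, edgeTerm q (fun x => a x / q) u e :=
      tsum_nonneg fun e => edgeTerm_nonneg (fun x => div_nonneg (ha x) hq0.le) e
    positivity
  · rw [vsum_eq_ofReal hus, huB]
  · rw [energy_eq_ofReal hp0 hq0 ha huJ, huσ, mul_div_cancel_left₀ _ two_ne_zero,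
      ENNReal.ofReal_toReal hS]
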